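/- arXiv:1902.09961 — 7 statements merged into one kernel-verified Lean document; each statement's English description precedes it below -/
import Mathlib

section
/- Let n ≥ 1 be an integer, μ > 0 a real number, F(θ) = √(∑_{k=0}^{n−1} (cos θ)^{2k}), and let Q* ∈ ℝ with Q* ∉ {0, 1, −1}. For the vector field X on ℝ³ given by X(θ,T,Q) = ( −6μ·F(θ)·((T−1)·cos θ + T)/n + 3Q(T−1)·F(θ)²·sin(2θ)/(2n), 3Q(T−1)²·T·(1−(cos θ)^{2n})/n, −3(Q²−1)(T−1)(1−(cos θ)^{2n}) ), the point (θ,T,Q) = (0, 1/2, Q*) is an equilibrium of X and it is unstable (it is not Lyapunov stable). -/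
open Real Filter

noncomputable section

/-- Lyapunov stability of the equilibrium `p` of the vector field `X` on the domain `D`. -/
def LyapunovStable {E : Type*} [NormedAddCommGroup E] [NormedSpace ℝ E]
    (X : E → E) (D : Set E) (p : E) : Prop :=
  ∀ ε > 0, ∃ δ > 0, ∀ γ : ℝ → E,
    (∀ t : ℝ, 0 ≤ t → γ t ∈ D) →
    (∀ t : ℝ, 0 ≤ t → HasDerivAt γ (X (γ t)) t) →
    ‖γ 0 - p‖ < δ → ∀ t : ℝ, 0 ≤ t → ‖γ t - p‖ < ε

/-- `F θ = √(∑_{k=0}^{n-1} (cos θ)^{2k})`. -/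
def F (n : ℕ) (θ : ℝ) : ℝ :=
  Real.sqrt (∑ k ∈ Finset.range n, Real.cos θ ^ (2 * k))

/-- The unwrapped vector field (flat, Λ ≠ 0, detailed balance, E-model potential);
coordinates `(θ, T, Q)`. -/
def X10 (n : ℕ) (μ : ℝ) (p : ℝ × ℝ × ℝ) : ℝ × ℝ × ℝ :=
  (-6 * μ * F n p.1 * ((p.2.1 - 1) * Real.cos p.1 + p.2.1) / n
      + 3 * p.2.2 * (p.2.1 - 1) * F n p.1 ^ 2 * Real.sin (2 * p.1) / (2 * n),
   3 * p.2.2 * (p.2.1 - 1) ^ 2 * p.2.1 * (1 - Real.cos p.1 ^ (2 * n)) / n,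
   -3 * (p.2.2 ^ 2 - 1) * (p.2.1 - 1) * (1 - Real.cos p.1 ^ (2 * n)))

/-- Two solutions of a locally Lipschitz autonomous ODE that agree at one time of an interval
agree on the whole interval. -/
lemma eqOn_Ioo_of_locallyLipschitz {E : Type*} [NormedAddCommGroup E] [NormedSpace ℝ E]
    [ProperSpace E] {X : E → E} (hX : LocallyLipschitz X) {f g : ℝ → E} {a b t₀ : ℝ}
    (ht₀ : t₀ ∈ Set.Ioo a b)
    (hf : ContinuousOn f (Set.Icc a b)) (hf' : ∀ t ∈ Set.Ioo a b, HasDerivAt f (X (f t)) t)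
    (hg : ContinuousOn g (Set.Icc a b)) (hg' : ∀ t ∈ Set.Ioo a b, HasDerivAt g (X (g t)) t)
    (h : f t₀ = g t₀) : Set.EqOn f g (Set.Ioo a b) := by
  have hK := (isCompact_Icc.image_of_continuousOn hf).union (isCompact_Icc.image_of_continuousOn hg)
  obtain ⟨K, hLip⟩ := LocallyLipschitzOn.exists_lipschitzOnWith_of_compact hK
    (hX.locallyLipschitzOn (s := f '' Set.Icc a b ∪ g '' Set.Icc a b))
  exact ODE_solution_unique_of_mem_Ioo (v := fun _ => X)
    (s := fun _ => f '' Set.Icc a b ∪ g '' Set.Icc a b) (fun _ _ => hLip) ht₀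
    (fun t ht => ⟨hf' t ht, .inl ⟨t, Set.Ioo_subset_Icc_self ht, rfl⟩⟩)
    (fun t ht => ⟨hg' t ht, .inr ⟨t, Set.Ioo_subset_Icc_self ht, rfl⟩⟩) h

lemma eq_of_locallyLipschitz {E : Type*} [NormedAddCommGroup E] [NormedSpace ℝ E]
    [ProperSpace E] {X : E → E} (hX : LocallyLipschitz X) {f g : ℝ → E} {t₀ : ℝ}
    (hf : ∀ t, HasDerivAt f (X (f t)) t) (hg : ∀ t, HasDerivAt g (X (g t)) t)
    (h : f t₀ = g t₀) : f = g := by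
  ext t
  refine eqOn_Ioo_of_locallyLipschitz hX (a := min t t₀ - 1) (b := max t t₀ + 1) (t₀ := t₀)
    ⟨?_, ?_⟩ (fun s _ => (hf s).continuousAt.continuousWithinAt) (fun s _ => hf s)
    (fun s _ => (hg s).continuousAt.continuousWithinAt) (fun s _ => hg s) h ⟨?_, ?_⟩
  · linarith [min_le_right t t₀]
  · linarith [le_max_right t t₀]
  · linarith [min_le_left t t₀]
  · linarith [le_max_left t t₀]

/-- A bounded locally Lipschitz vector field is complete. -/
lemma exists_global_solution {E : Type*} [NormedAddCommGroup E] [NormedSpace ℝ E]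
    [ProperSpace E] {X : E → E} (hX : LocallyLipschitz X) {M : ℝ} (hM : ∀ x, ‖X x‖ ≤ M) (x₀ : E) :
    ∃ γ : ℝ → E, γ 0 = x₀ ∧ ∀ t, HasDerivAt γ (X (γ t)) t := by
  have hM0 : 0 ≤ M := (norm_nonneg _).trans (hM x₀)
  have hloc : ∀ N : ℕ, ∃ α : ℝ → E, α 0 = x₀ ∧
      ∀ t ∈ Set.Icc (-(N : ℝ)) N, HasDerivWithinAt α (X (α t)) (Set.Icc (-(N : ℝ)) N) t := by
    intro N
    obtain ⟨K, hLip⟩ := LocallyLipschitzOn.exists_lipschitzOnWith_of_compact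
      (isCompact_closedBall x₀ ((M.toNNReal * N : NNReal) : ℝ)) hX.locallyLipschitzOn
    have hN : (0 : ℝ) ∈ Set.Icc (-(N : ℝ)) N := by simp
    have hPL : IsPicardLindelof (fun _ => X) (⟨0, hN⟩ : Set.Icc (-(N : ℝ)) N) x₀
        (M.toNNReal * N) 0 M.toNNReal K := by
      refine IsPicardLindelof.of_time_independent (fun x _ => ?_) hLip ?_
      · simpa [hM0] using hM x
      · simp
    exact hPL.exists_eq_forall_mem_Icc_hasDerivWithinAt₀
  choose α hα0 hα using hloc
  have hcont : ∀ N : ℕ, ContinuousOn (α N) (Set.Icc (-(N : ℝ)) N) :=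
    fun N t ht => (hα N t ht).continuousWithinAt
  have hder : ∀ N : ℕ, ∀ t ∈ Set.Ioo (-(N : ℝ)) N, HasDerivAt (α N) (X (α N t)) t :=
    fun N t ht => (hα N t (Set.Ioo_subset_Icc_self ht)).hasDerivAt (Icc_mem_nhds ht.1 ht.2)
  have hagree : ∀ N N' : ℕ, N ≤ N' → ∀ t ∈ Set.Ioo (-(N : ℝ)) N, α N t = α N' t := by
    intro N N' hNN' t ht
    have hle : (N : ℝ) ≤ N' := by exact_mod_cast hNN'
    have hsub : Set.Ioo (-(N : ℝ)) N ⊆ Set.Ioo (-(N' : ℝ)) N' :=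
      Set.Ioo_subset_Ioo (by linarith) hle
    refine eqOn_Ioo_of_locallyLipschitz hX (t₀ := 0) ⟨by linarith [ht.1, ht.2], by
      linarith [ht.1, ht.2]⟩ (hcont N) (hder N)
      ((hcont N').mono (Set.Icc_subset_Icc (by linarith) hle)) (fun s hs => hder N' s (hsub hs))
      (by rw [hα0, hα0]) ht
  have hmem : ∀ (t : ℝ) (N : ℕ), |t| < N → t ∈ Set.Ioo (-(N : ℝ)) N := fun t N h => abs_lt.1 h
  have hceil : ∀ t : ℝ, |t| < ((⌈|t|⌉₊ + 1 : ℕ) : ℝ) := fun t => by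
    push_cast; linarith [Nat.le_ceil |t|]
  have heq : ∀ (t : ℝ) (N : ℕ), |t| < N → α (⌈|t|⌉₊ + 1) t = α N t := by
    intro t N h
    rcases le_total (⌈|t|⌉₊ + 1) N with hle | hle
    · exact hagree _ _ hle t (hmem _ _ (hceil t))
    · exact (hagree _ _ hle t (hmem _ _ h)).symm
  refine ⟨fun t => α (⌈|t|⌉₊ + 1) t, hα0 _, fun t => ?_⟩
  have hnear : (fun s => α (⌈|s|⌉₊ + 1) s) =ᶠ[nhds t] α (⌈|t|⌉₊ + 1) := by
    filter_upwards [Ioo_mem_nhds (hmem t _ (hceil t)).1 (hmem t _ (hceil t)).2] with s hs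
    exact heq s _ (abs_lt.2 hs)
  exact (hder _ t (hmem _ _ (hceil t))).congr_of_eventuallyEq hnear

/-- A function whose derivative is negative wherever it takes the value `c` cannot cross `c`
upwards. -/
lemma le_of_deriv_neg_at_level {f f' : ℝ → ℝ} {a c : ℝ} (hf : ∀ t, a ≤ t → HasDerivAt f (f' t) t)
    (ha : f a ≤ c) (h : ∀ t, a ≤ t → f t = c → f' t < 0) {t : ℝ} (ht : a ≤ t) : f t ≤ c :=
  image_le_of_deriv_right_lt_deriv_boundary' (f' := f') (B := fun _ => c) (B' := fun _ => 0)
    (fun s hs => (hf s hs.1).continuousAt.continuousWithinAt)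
    (fun s hs => (hf s hs.1).hasDerivWithinAt) ha continuousOn_const
    (fun _ _ => hasDerivWithinAt_const _ _ _) (fun s hs hsc => h s hs.1 hsc) ⟨ht, le_rfl⟩

/-- A function whose derivative is at most `d` wherever it exceeds the line of slope `d` stays below
that line. -/
lemma le_add_mul_of_deriv_le {f f' : ℝ → ℝ} {a c d : ℝ} (hf : ∀ t, a ≤ t → HasDerivAt f (f' t) t)
    (ha : f a ≤ c) (h : ∀ t, a ≤ t → c + d * (t - a) ≤ f t → f' t ≤ d) {t : ℝ} (ht : a ≤ t) :
    f t ≤ c + d * (t - a) := by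
  refine le_of_forall_pos_le_add fun ε hε => ?_
  have hη : 0 < ε / (t - a + 1) := by apply div_pos hε; linarith
  have key := le_of_deriv_neg_at_level (a := a) (c := c) (t := t)
    (f := fun s => f s - (d + ε / (t - a + 1)) * (s - a))
    (f' := fun s => f' s - (d + ε / (t - a + 1)))
    (fun s hs => by
      simpa using! (hf s hs).sub (((hasDerivAt_id s).sub_const a).const_mul _)) (by simpa using ha)
    (fun s hs hsc => by
      have hpos : 0 ≤ ε / (t - a + 1) * (s - a) := mul_nonneg hη.le (by linarith)
      have := h s hs (by nlinarith)
      linarith) ht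
  have : ε / (t - a + 1) * (t - a) ≤ ε := by
    rw [div_mul_eq_mul_div, div_le_iff₀ (by linarith)]; nlinarith
  nlinarith

lemma le_of_deriv_nonpos_above {f f' : ℝ → ℝ} {a c : ℝ} (hf : ∀ t, a ≤ t → HasDerivAt f (f' t) t)
    (ha : f a ≤ c) (h : ∀ t, a ≤ t → c ≤ f t → f' t ≤ 0) {t : ℝ} (ht : a ≤ t) : f t ≤ c := by
  simpa using le_add_mul_of_deriv_le (d := 0) hf ha (by simpa using h) ht

lemma one_sub_cos_pow (n : ℕ) (θ : ℝ) : F n θ ^ 2 * (1 - cos θ ^ 2) = 1 - cos θ ^ (2 * n) := by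
  rw [F, Real.sq_sqrt (Finset.sum_nonneg fun k _ => by rw [pow_mul]; positivity)]
  simp_rw [pow_mul]
  exact geom_sum_mul_neg _ _

lemma one_le_sum_even_pow {n : ℕ} (hn : 1 ≤ n) (c : ℝ) :
    1 ≤ ∑ k ∈ Finset.range n, c ^ (2 * k) := by
  have := Finset.single_le_sum (f := fun k => c ^ (2 * k)) (s := Finset.range n)
    (fun k _ => by rw [pow_mul]; positivity) (Finset.mem_range.2 hn)
  simpa using this

lemma one_le_F {n : ℕ} (hn : 1 ≤ n) (θ : ℝ) : 1 ≤ F n θ :=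
  Real.one_le_sqrt.2 (one_le_sum_even_pow hn _)

lemma contDiff_F {n : ℕ} (hn : 1 ≤ n) : ContDiff ℝ 1 (F n) := by
  refine ContDiff.sqrt (by fun_prop) fun θ => ?_
  linarith [one_le_sum_even_pow hn (cos θ)]

lemma F_le (n : ℕ) (θ : ℝ) : F n θ ≤ Real.sqrt n := by
  refine Real.sqrt_le_sqrt ?_
  calc ∑ k ∈ Finset.range n, cos θ ^ (2 * k) ≤ ∑ k ∈ Finset.range n, (1 : ℝ) :=
        Finset.sum_le_sum fun k _ => by
          rw [pow_mul]; exact pow_le_one₀ (sq_nonneg _) (cos_sq_le_one θ)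
    _ = n := by simp

lemma one_sub_cos_pow_nonneg (n : ℕ) (θ : ℝ) : 0 ≤ 1 - cos θ ^ (2 * n) := by
  rw [pow_mul, sub_nonneg]; exact pow_le_one₀ (sq_nonneg _) (cos_sq_le_one θ)

lemma sin_sq_le_one_sub_cos_pow {n : ℕ} (hn : 1 ≤ n) (θ : ℝ) :
    sin θ ^ 2 ≤ 1 - cos θ ^ (2 * n) := by
  rw [← one_sub_cos_pow, sin_sq]
  have h1 : 1 ≤ F n θ ^ 2 := one_le_pow₀ (one_le_F hn θ)
  nlinarith [cos_sq_le_one θ]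

lemma contDiff_X10 {n : ℕ} (hn : 1 ≤ n) (μ : ℝ) : ContDiff ℝ 1 (X10 n μ) := by
  have hF := contDiff_F hn
  unfold X10
  fun_prop

lemma X10_fst_eq {n : ℕ} (hn : 1 ≤ n) (μ : ℝ) (p : ℝ × ℝ × ℝ) :
    (X10 n μ p).1 = 3 / n * (-(2 * μ * F n p.1 * (2 * p.2.1 - 1))
      - F n p.1 * (1 - p.2.1) * (2 * μ * (1 - cos p.1))
      - p.2.2 * (1 - p.2.1) * F n p.1 ^ 2 * (sin p.1 * cos p.1)) := by
  have : (n : ℝ) ≠ 0 := by positivity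
  simp only [X10, sin_two_mul]
  field_simp
  ring

lemma X10_snd_fst_eq (n : ℕ) (μ : ℝ) (p : ℝ × ℝ × ℝ) :
    (X10 n μ p).2.1 = 3 / n * (p.2.2 * (1 - p.2.1) ^ 2 * p.2.1 * (1 - cos p.1 ^ (2 * n))) := by
  simp only [X10]
  ring

lemma half_abs_le_abs_sin {θ : ℝ} (h : |θ| ≤ 1) : |θ| / 2 ≤ |sin θ| := by
  have h1 := mul_abs_le_abs_sin (x := θ) (by linarith [pi_gt_three])
  have h2 : 1 / 2 ≤ 2 / π := by
    rw [div_le_div_iff₀ two_pos pi_pos]; linarith [pi_le_four]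
  nlinarith [abs_nonneg θ]

lemma half_le_cos {θ : ℝ} (h : |θ| ≤ 1) : 1 / 2 ≤ cos θ := by
  have := one_sub_sq_div_two_le_cos (x := θ)
  nlinarith [abs_nonneg θ, sq_abs θ]

/-- Near an equilibrium with `q < 0`, solutions starting at `θ > 0`, `T ≤ 1 / 2` leave a fixed
ball. -/
lemma exists_escape_of_neg {n : ℕ} (hn : 1 ≤ n) {μ : ℝ} (hμ : 0 < μ) {q : ℝ} (hq : q < 0) :
    ∃ ε > 0, ∀ γ : ℝ → ℝ × ℝ × ℝ, (∀ t, 0 ≤ t → HasDerivAt γ (X10 n μ (γ t)) t) →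
      0 < (γ 0).1 → (γ 0).2.1 ≤ 1 / 2 → ∃ t, 0 ≤ t ∧ ε ≤ ‖γ t - (0, 1 / 2, q)‖ := by
  have hn0 : (0 : ℝ) < n := by exact_mod_cast hn
  refine ⟨min (1 / 4) (min (-q / 2) (-q / (16 * μ))), by
    refine lt_min (by norm_num) (lt_min (by linarith) (div_pos (by linarith) (by positivity))), ?_⟩
  intro γ hγ hθ0 hT0
  by_contra! hcon
  have hball : ∀ t, 0 ≤ t → |(γ t).1| < 1 / 4 ∧ |(γ t).1| * (16 * μ) ≤ -q ∧
      |(γ t).2.1 - 1 / 2| < 1 / 4 ∧ |(γ t).2.2 - q| < -q / 2 := by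
    intro t ht
    have h := hcon t ht
    simp only [Prod.norm_def, Prod.fst_sub, Prod.snd_sub, sub_zero, Real.norm_eq_abs, max_lt_iff,
      lt_min_iff] at h
    obtain ⟨⟨h1, h3, -⟩, ⟨-, -, h4⟩, h2, -⟩ := h
    exact ⟨h1, ((lt_div_iff₀ (by positivity)).1 h2).le, h3, h4⟩
  have hd1 : ∀ t, 0 ≤ t → HasDerivAt (fun t => (γ t).1) (X10 n μ (γ t)).1 t :=
    fun t ht => (hγ t ht).fst
  have hd2 : ∀ t, 0 ≤ t → HasDerivAt (fun t => (γ t).2.1) (X10 n μ (γ t)).2.1 t :=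
    fun t ht => (hγ t ht).snd.fst
  have hT : ∀ t, 0 ≤ t → (γ t).2.1 ≤ 1 / 2 := fun t ht =>
    le_of_deriv_nonpos_above hd2 hT0 (fun s hs _ => by
      obtain ⟨-, -, h3, h4⟩ := hball s hs
      rw [abs_lt] at h3 h4
      rw [X10_snd_fst_eq]
      refine mul_nonpos_of_nonneg_of_nonpos (by positivity)
        (mul_nonpos_of_nonpos_of_nonneg (mul_nonpos_of_nonpos_of_nonneg
          (mul_nonpos_of_nonpos_of_nonneg ?_ (sq_nonneg _)) ?_) (one_sub_cos_pow_nonneg _ _)) <;>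
      linarith) ht
  have hgrow : ∀ t, 0 ≤ t → 0 ≤ (γ t).1 →
      3 / n * (1 / 64 * (-q * (γ t).1)) ≤ (X10 n μ (γ t)).1 := by
    intro t ht hθ
    obtain ⟨h1, h2, h3, h4⟩ := hball t ht
    have hT' := hT t ht
    rw [X10_fst_eq hn]
    gcongr ?_ * ?_
    generalize (γ t).1 = θ at *
    generalize (γ t).2.1 = T at *
    generalize (γ t).2.2 = Q at *
    have hs := half_abs_le_abs_sin (θ := θ) (by linarith)
    have hc := half_le_cos (θ := θ) (by linarith)
    have hc2 := one_sub_sq_div_two_le_cos (x := θ)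
    have hF := one_le_F hn θ
    rw [abs_of_nonneg hθ] at h1 h2 hs
    rw [abs_of_nonneg (sin_nonneg_of_nonneg_of_le_pi hθ (by linarith [pi_gt_three]))] at hs
    rw [abs_lt] at h3 h4
    have hsc : θ / 4 ≤ sin θ * cos θ := by nlinarith
    have hQsc : -q / 2 * (θ / 4) ≤ -Q * (sin θ * cos θ) :=
      mul_le_mul (by linarith) hsc (by linarith) (by linarith)
    have hcos : 2 * μ * (1 - cos θ) ≤ μ * θ ^ 2 := by nlinarith
    have hμθ : μ * θ ^ 2 ≤ -q * θ / 16 := by nlinarith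
    have hFQ : -Q * (sin θ * cos θ) ≤ F n θ * (-Q * (sin θ * cos θ)) :=
      le_mul_of_one_le_left (le_trans (by nlinarith) hQsc) hF
    have hB : 1 / 16 * (-q * θ) ≤ F n θ * (-Q * (sin θ * cos θ)) - 2 * μ * (1 - cos θ) := by
      linarith
    have hFw : 1 / 4 ≤ F n θ * (1 - T) := by nlinarith
    have h5 : 1 / 4 * (1 / 16 * (-q * θ)) ≤
        F n θ * (1 - T) * (F n θ * (-Q * (sin θ * cos θ)) - 2 * μ * (1 - cos θ)) :=
      mul_le_mul hFw hB (by nlinarith) (by linarith)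
    have h6 : 0 ≤ 2 * μ * F n θ * (1 - 2 * T) := by
      apply mul_nonneg (by positivity); linarith
    nlinarith
  have hge : ∀ t, 0 ≤ t → (γ 0).1 ≤ (γ t).1 := fun t ht => by
    have := le_of_deriv_neg_at_level (c := -(γ 0).1) (fun s hs => (hd1 s hs).neg) le_rfl
      (fun s hs hsc => by
        have hsc' : (γ s).1 = (γ 0).1 := by simpa using hsc
        have := hgrow s hs (hsc' ▸ hθ0.le)
        have h2 : 0 < 3 / n * (1 / 64 * (-q * (γ s).1)) := by
          have : 0 < -q * (γ s).1 := mul_pos (by linarith) (hsc' ▸ hθ0)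
          positivity
        linarith) ht
    simpa using this
  have hd : 0 < 3 / n * (1 / 64 * (-q * (γ 0).1)) := by
    have : 0 < -q * (γ 0).1 := mul_pos (by linarith) hθ0
    positivity
  set d := 3 / n * (1 / 64 * (-q * (γ 0).1)) with hd_def
  have hlin := le_add_mul_of_deriv_le (c := -(γ 0).1) (d := -d) (fun s hs => (hd1 s hs).neg) le_rfl
    (fun s hs _ => by
      have h1 := hgrow s hs (hθ0.le.trans (hge s hs))
      have h2 : d ≤ 3 / n * (1 / 64 * (-q * (γ s).1)) := by
        rw [hd_def]
        have := hge s hs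
        have : 0 ≤ -q := by linarith
        gcongr
      linarith) (t := 1 / d) (by positivity)
  have h1 := (hball (1 / d) (by positivity)).1
  rw [abs_lt] at h1
  have h2 : -d * (1 / d - 0) = -1 := by field_simp; ring
  rw [h2] at hlin
  simp only [Pi.neg_apply] at hlin
  linarith

/-- Near an equilibrium with `q > 0`, solutions starting at `T > 1 / 2` leave a fixed ball. -/
lemma exists_escape_of_pos {n : ℕ} (hn : 1 ≤ n) {μ : ℝ} (hμ : 0 < μ) {q : ℝ} (hq : 0 < q) :
    ∃ ε > 0, ∀ γ : ℝ → ℝ × ℝ × ℝ, (∀ t, 0 ≤ t → HasDerivAt γ (X10 n μ (γ t)) t) →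
      1 / 2 < (γ 0).2.1 → ∃ t, 0 ≤ t ∧ ε ≤ ‖γ t - (0, 1 / 2, q)‖ := by
  have hn0 : (0 : ℝ) < n := by exact_mod_cast hn
  refine ⟨min (1 / 4) (q / 2), lt_min (by norm_num) (by linarith), ?_⟩
  intro γ hγ hT0
  by_contra! hcon
  have hball : ∀ t, 0 ≤ t → |(γ t).1| < 1 / 4 ∧
      |(γ t).2.1 - 1 / 2| < 1 / 4 ∧ |(γ t).2.2 - q| < q / 2 := by
    intro t ht
    have h := hcon t ht
    simp only [Prod.norm_def, Prod.fst_sub, Prod.snd_sub, sub_zero, Real.norm_eq_abs, max_lt_iff,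
      lt_min_iff] at h
    exact ⟨h.1.1, h.1.2.1, h.2.2.2⟩
  have hd1 : ∀ t, 0 ≤ t → HasDerivAt (fun t => (γ t).1) (X10 n μ (γ t)).1 t :=
    fun t ht => (hγ t ht).fst
  have hd2 : ∀ t, 0 ≤ t → HasDerivAt (fun t => (γ t).2.1) (X10 n μ (γ t)).2.1 t :=
    fun t ht => (hγ t ht).snd.fst
  have hT'low : ∀ t, 0 ≤ t →
      3 / n * (q / 2 * (1 / 4) ^ 2 * (1 / 4) * sin (γ t).1 ^ 2) ≤ (X10 n μ (γ t)).2.1 := by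
    intro t ht
    obtain ⟨h1, h3, h4⟩ := hball t ht
    rw [abs_lt] at h3 h4
    rw [X10_snd_fst_eq]
    have hs := sin_sq_le_one_sub_cos_pow hn (γ t).1
    have hQ : 0 ≤ (γ t).2.2 := by linarith
    have hT : 0 ≤ (γ t).2.1 := by linarith
    gcongr <;> linarith
  have hT : ∀ t, 0 ≤ t → (γ 0).2.1 ≤ (γ t).2.1 := fun t ht => by
    have := le_of_deriv_nonpos_above (c := -(γ 0).2.1) (fun s hs => (hd2 s hs).neg) le_rfl
      (fun s hs _ => by
        have h1 := hT'low s hs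
        have h2 : 0 ≤ 3 / n * (q / 2 * (1 / 4) ^ 2 * (1 / 4) * sin (γ s).1 ^ 2) := by positivity
        linarith) ht
    simpa using this
  obtain ⟨u, hu, hTu⟩ : ∃ u > 0, (γ 0).2.1 = 1 / 2 + u :=
    ⟨(γ 0).2.1 - 1 / 2, by linarith, by ring⟩
  have hκ0 : 0 < 4 * μ * u / (3 * q * n) := by positivity
  have hκeq : 3 * q * n * (4 * μ * u / (3 * q * n)) = 4 * μ * u := by field_simp
  set κ := 4 * μ * u / (3 * q * n)
  have hd0 : 0 < 6 * μ * u / n := by positivity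
  have hθ' : ∀ t, 0 ≤ t → -κ ≤ (γ t).1 → (X10 n μ (γ t)).1 ≤ -(6 * μ * u / n) := by
    intro t ht hθ
    obtain ⟨h1, h3, h4⟩ := hball t ht
    have hTt := hT t ht
    rw [hTu] at hTt
    rw [X10_fst_eq hn, show -(6 * μ * u / n) = 3 / n * -(2 * μ * u) by ring]
    gcongr ?_ * ?_
    generalize (γ t).1 = θ at *
    generalize (γ t).2.1 = T at *
    generalize (γ t).2.2 = Q at *
    have hc := half_le_cos (θ := θ) (by linarith)
    have hF := one_le_F hn θ
    have hF2 : F n θ ^ 2 ≤ n := by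
      have := pow_le_pow_left₀ (by linarith) (F_le n θ) 2
      rwa [Real.sq_sqrt (by positivity)] at this
    rw [abs_lt] at h1 h3 h4
    have hA : 2 * μ * 1 * (2 * u) ≤ 2 * μ * F n θ * (2 * T - 1) := by
      gcongr; linarith
    have hB : 0 ≤ F n θ * (1 - T) * (2 * μ * (1 - cos θ)) := by
      have := cos_le_one θ
      refine mul_nonneg (mul_nonneg ?_ ?_) (mul_nonneg ?_ ?_) <;> linarith
    have hsc : -κ ≤ sin θ * cos θ := by
      rcases le_total 0 θ with h | h
      · have := sin_nonneg_of_nonneg_of_le_pi h (by linarith [pi_gt_three])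
        nlinarith
      · have h5 : θ ≤ sin θ := by
          have := sin_le (x := -θ) (by linarith)
          rw [sin_neg] at this; linarith
        nlinarith [cos_le_one θ]
    have hcoef : 0 ≤ Q * (1 - T) * F n θ ^ 2 :=
      mul_nonneg (mul_nonneg (by linarith) (by linarith)) (sq_nonneg _)
    have hcoef2 : Q * (1 - T) * F n θ ^ 2 ≤ 3 * q / 2 * 1 * n := by
      gcongr <;> linarith
    have hC : -(3 * q / 2 * 1 * n * κ) ≤ Q * (1 - T) * F n θ ^ 2 * (sin θ * cos θ) := by
      nlinarith
    linarith
  have hex : ∃ t, 0 ≤ t ∧ (γ t).1 ≤ -κ := by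
    by_contra! hno
    have hlin := le_add_mul_of_deriv_le (c := (γ 0).1) (d := -(6 * μ * u / n)) hd1 le_rfl
      (fun s hs _ => hθ' s hs (hno s hs).le) (t := 1 / (6 * μ * u / n)) (by positivity)
    have h1 := (hball 0 le_rfl).1
    have h2 := (hball (1 / (6 * μ * u / n)) (by positivity)).1
    rw [abs_lt] at h1 h2
    have h3 : -(6 * μ * u / n) * (1 / (6 * μ * u / n) - 0) = -1 := by field_simp; ring
    rw [h3] at hlin
    linarith
  obtain ⟨t₁, ht₁, hθ₁⟩ := hex
  have hθle : ∀ t, t₁ ≤ t → (γ t).1 ≤ -κ := fun t ht =>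
    le_of_deriv_neg_at_level (fun s hs => hd1 s (ht₁.trans hs)) hθ₁
      (fun s hs hsc => by linarith [hθ' s (ht₁.trans hs) hsc.ge]) ht
  set d := 3 / n * (q / 2 * (1 / 4) ^ 2 * (1 / 4) * (κ / 2) ^ 2) with hd_def
  have hd : 0 < d := by positivity
  have hlin := le_add_mul_of_deriv_le (a := t₁) (c := -(γ t₁).2.1) (d := -d)
    (fun s hs => (hd2 s (ht₁.trans hs)).neg) le_rfl
    (fun s hs _ => by
      have h1 := hT'low s (ht₁.trans hs)
      have h2 := half_abs_le_abs_sin (θ := (γ s).1) (by linarith [(hball s (ht₁.trans hs)).1])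
      have h3 : κ ≤ |(γ s).1| := by
        rw [le_abs]; right; linarith [hθle s hs]
      have h4 : (κ / 2) ^ 2 ≤ sin (γ s).1 ^ 2 := by
        rw [← sq_abs (sin _)]; gcongr; linarith
      have h5 : d ≤ 3 / n * (q / 2 * (1 / 4) ^ 2 * (1 / 4) * sin (γ s).1 ^ 2) := by
        rw [hd_def]; gcongr
      linarith) (t := t₁ + 1 / d) (by linarith [one_div_pos.2 hd])
  have h1 := (hball t₁ ht₁).2.1
  have h2 := (hball (t₁ + 1 / d) (by positivity)).2.1
  rw [abs_lt] at h1 h2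
  have h3 : -d * (t₁ + 1 / d - t₁) = -1 := by field_simp; ring
  rw [h3] at hlin
  simp only [Pi.neg_apply] at hlin
  linarith

/-- In the strip `0 ≤ T ≤ 1` solutions starting at `Q ≤ 1` are global. -/
lemma exists_solution_of_le_one {n : ℕ} (hn : 1 ≤ n) (μ θ₀ : ℝ) {T₀ Q₀ : ℝ}
    (hT0 : 0 ≤ T₀) (hT1 : T₀ ≤ 1) (hQ1 : Q₀ ≤ 1) :
    ∃ γ : ℝ → ℝ × ℝ × ℝ, γ 0 = (θ₀, T₀, Q₀) ∧
      ∀ t, 0 ≤ t → HasDerivAt γ (X10 n μ (γ t)) t := by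
  set M : ℝ := max 1 |Q₀| with hM
  have hM1 : 1 ≤ M := le_max_left _ _
  have hMQ : -M ≤ Q₀ := by linarith [le_max_right 1 |Q₀|, neg_abs_le Q₀]
  set clip : ℝ × ℝ × ℝ → ℝ × ℝ × ℝ :=
    fun p => (p.1, max 0 (min 1 p.2.1), max (-M) (min 1 p.2.2)) with hclip
  have hclipLip : LocallyLipschitz clip := by
    have h1 : LocallyLipschitz (fun p : ℝ × ℝ × ℝ => p.1) := LipschitzWith.prod_fst.locallyLipschitz
    have h2 : LocallyLipschitz (fun p : ℝ × ℝ × ℝ => p.2.1) :=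
      (LipschitzWith.prod_fst.comp LipschitzWith.prod_snd).locallyLipschitz
    have h3 : LocallyLipschitz (fun p : ℝ × ℝ × ℝ => p.2.2) :=
      (LipschitzWith.prod_snd.comp LipschitzWith.prod_snd).locallyLipschitz
    exact h1.prodMk (((h2.const_min 1).const_max 0).prodMk ((h3.const_min 1).const_max (-M)))
  have hLip : LocallyLipschitz (fun p => X10 n μ (clip p)) :=
    (contDiff_X10 hn μ).locallyLipschitz.comp hclipLip
  have hper : ∀ θ T Q : ℝ, ∃ φ ∈ Set.Icc 0 (2 * π), X10 n μ (θ, T, Q) = X10 n μ (φ, T, Q) := by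
    intro θ T Q
    have : Function.Periodic (fun θ => X10 n μ (θ, T, Q)) (2 * π) := by
      intro θ
      simp only [X10, F, cos_add_two_pi, sin_two_mul, sin_add_two_pi]
    obtain ⟨φ, hφ, h⟩ := this.exists_mem_Ico₀ (by positivity) θ
    exact ⟨φ, Set.Ico_subset_Icc_self hφ, h⟩
  obtain ⟨B, hB⟩ := (isCompact_Icc.prod (isCompact_Icc.prod isCompact_Icc) :
    IsCompact (Set.Icc 0 (2 * π) ×ˢ Set.Icc (0 : ℝ) 1 ×ˢ Set.Icc (-M) 1)).exists_bound_of_continuousOn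
    (contDiff_X10 hn μ).continuous.continuousOn
  obtain ⟨γ, hγ0, hγ⟩ := exists_global_solution hLip (M := B) (fun p => by
    obtain ⟨φ, hφ, h⟩ := hper p.1 (max 0 (min 1 p.2.1)) (max (-M) (min 1 p.2.2))
    simp only [hclip, h]
    exact hB _ ⟨hφ, ⟨le_max_left _ _, max_le zero_le_one (min_le_left _ _)⟩,
      ⟨le_max_left _ _, max_le (by linarith) (min_le_left _ _)⟩⟩) (θ₀, T₀, Q₀)
  refine ⟨γ, hγ0, fun t ht => ?_⟩
  have hd2 : ∀ t, 0 ≤ t → HasDerivAt (fun t => (γ t).2.1) (X10 n μ (clip (γ t))).2.1 t :=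
    fun t _ => (hγ t).snd.fst
  have hd3 : ∀ t, 0 ≤ t → HasDerivAt (fun t => (γ t).2.2) (X10 n μ (clip (γ t))).2.2 t :=
    fun t _ => (hγ t).snd.snd
  have hTle : (γ t).2.1 ≤ 1 := le_of_deriv_nonpos_above hd2 (by simpa [hγ0]) (fun s _ h => by
    simp [X10, hclip, h]) ht
  have hTge : -(γ t).2.1 ≤ 0 := le_of_deriv_nonpos_above (fun s hs => (hd2 s hs).neg)
    (by simpa [hγ0]) (fun s _ h => by
      have h' : (γ s).2.1 ≤ 0 := by simpa using h
      simp [X10, hclip, h', h'.trans zero_le_one]) ht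
  have hQle : (γ t).2.2 ≤ 1 := le_of_deriv_nonpos_above hd3 (by simpa [hγ0]) (fun s _ h => by
    have : max (-M) (1 : ℝ) = 1 := max_eq_right (by linarith)
    simp [X10, hclip, h, this]) ht
  have hQge : -(γ t).2.2 ≤ M := le_of_deriv_nonpos_above (fun s hs => (hd3 s hs).neg)
    (by simp [hγ0]; linarith) (fun s _ h => by
      have h' : (γ s).2.2 ≤ -M := by simp at h; linarith
      have h1 : min 1 (γ s).2.2 = (γ s).2.2 := min_eq_right (by linarith)
      have h2 : max 0 (min 1 (γ s).2.1) ≤ 1 := max_le zero_le_one (min_le_left _ _)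
      simp only [X10, hclip, h1, max_eq_left h']
      have h3 := one_sub_cos_pow_nonneg n (γ s).1
      have h4 : 0 ≤ ((-M) ^ 2 - 1) * (1 - max 0 (min 1 (γ s).2.1)) :=
        mul_nonneg (by nlinarith) (by linarith)
      nlinarith [mul_nonneg h4 h3]) ht
  have hid : clip (γ t) = γ t := by
    simp only [hclip]
    rw [min_eq_right hTle, max_eq_right (by linarith), min_eq_right hQle,
      max_eq_right (by linarith)]
  simpa only [hid] using hγ t

/-- The profile `e ^ (n - 1) / √(e ^ (2 n) + C)` of the rescaled equations. -/
def profile (n : ℕ) (C e : ℝ) : ℝ := e ^ (n - 1) / √(e ^ (2 * n) + C)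

/-- The field `X10` on the surface `(Q ^ 2 - 1) ((1 - T) / T) ^ (2 n) = C`, after the substitution
`T = 1 / (1 + exp (-L))` and a change of time; the coordinates are `(θ, L)`. -/
def rescaledField (n : ℕ) (μ C : ℝ) (p : ℝ × ℝ) : ℝ × ℝ :=
  (-(F n p.1 ^ 2 * (sin p.1 * cos p.1))
      - 2 * μ * F n p.1 * (1 - exp (-p.2) * cos p.1) * profile n C (exp (-p.2)),
    1 - cos p.1 ^ (2 * n))

/-- The derivative of the physical time with respect to the time of `rescaledField`. -/
def clock (n : ℕ) (C L : ℝ) : ℝ := n / 3 * ((1 + exp (-L)) * profile n C (exp (-L)))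

lemma sqrt_pow_add_pos {n : ℕ} {C e : ℝ} (hC : 0 < C) : 0 < √(e ^ (2 * n) + C) := by
  have : 0 ≤ e ^ (2 * n) := by rw [pow_mul]; positivity
  positivity

lemma contDiff_profile (n : ℕ) {C : ℝ} (hC : 0 < C) : ContDiff ℝ 1 (profile n C) := by
  unfold profile
  refine ContDiff.div (by fun_prop) (ContDiff.sqrt (by fun_prop) fun e => ?_)
    fun e => (sqrt_pow_add_pos hC).ne'
  exact (sqrt_pos.1 (sqrt_pow_add_pos hC)).ne'

lemma profile_pos (n : ℕ) {C e : ℝ} (hC : 0 < C) (he : 0 < e) : 0 < profile n C e :=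
  div_pos (pow_pos he _) (sqrt_pow_add_pos hC)

lemma clock_pos {n : ℕ} (hn : 1 ≤ n) {C : ℝ} (hC : 0 < C) (L : ℝ) : 0 < clock n C L := by
  have := profile_pos n hC (exp_pos (-L))
  have : (0 : ℝ) < n := by exact_mod_cast hn
  have := exp_pos (-L)
  unfold clock
  positivity

lemma continuous_clock (n : ℕ) {C : ℝ} (hC : 0 < C) : Continuous (clock n C) := by
  have := (contDiff_profile n hC).continuous
  unfold clock
  fun_prop

lemma mul_profile {n : ℕ} (hn : 1 ≤ n) (C e : ℝ) :
    e * profile n C e = e ^ n / √(e ^ (2 * n) + C) := by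
  rw [profile, mul_div_assoc', mul_pow_sub_one (by omega)]

lemma mul_profile_le_one {n : ℕ} (hn : 1 ≤ n) {C : ℝ} (hC : 0 < C) (e : ℝ) :
    e * profile n C e ≤ 1 := by
  rw [mul_profile hn, div_le_one (sqrt_pow_add_pos hC)]
  refine Real.le_sqrt_of_sq_le ?_
  rw [← pow_mul, mul_comm n]
  linarith

lemma profile_le {n : ℕ} (hn : 1 ≤ n) {C e : ℝ} (hC : 0 < C) (he : 0 ≤ e) :
    profile n C e ≤ 1 / √C + 1 := by
  have h0 : 0 ≤ e ^ (2 * n) := by positivity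
  rcases le_total e 1 with h | h
  · have : profile n C e ≤ 1 / √C := by
      unfold profile
      gcongr
      · exact pow_le_one₀ he h
      · linarith
    linarith
  · have h1 : 0 ≤ profile n C e := by unfold profile; positivity
    have h2 := mul_profile_le_one hn hC e
    have : 0 ≤ 1 / √C := by positivity
    nlinarith

/-- The clock runs at a positive speed as long as `L` stays bounded above. -/
lemma le_clock {n : ℕ} (hn : 1 ≤ n) {C L B : ℝ} (hC : 0 < C) (hL : L ≤ B) :
    n / 3 * (exp (-B) ^ n / √(exp (-B) ^ (2 * n) + C)) ≤ clock n C L := by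
  unfold clock
  have h1 := profile_pos n hC (exp_pos (-L))
  have h2 : exp (-B) ^ n ≤ exp (-L) ^ n := by gcongr
  have h3 : exp (-B) ^ n / √(exp (-B) ^ (2 * n) + C) ≤
      exp (-L) * profile n C (exp (-L)) := by
    rw [mul_profile hn, div_le_div_iff₀ (sqrt_pow_add_pos hC) (sqrt_pow_add_pos hC)]
    rw [mul_comm 2 n, pow_mul, pow_mul]
    have hB : 0 < exp (-B) ^ n := by positivity
    refine abs_le_of_sq_le_sq' ?_ (by positivity) |>.2
    rw [mul_pow, mul_pow, sq_sqrt (by positivity), sq_sqrt (by positivity)]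
    nlinarith [pow_le_pow_left₀ hB.le h2 2]
  gcongr
  nlinarith

lemma abs_one_sub_exp_mul_cos_le (θ L : ℝ) : |1 - exp (-L) * cos θ| ≤ 1 + exp (-L) := by
  have h := exp_pos (-L)
  rw [abs_le]
  constructor <;> nlinarith [neg_one_le_cos θ, cos_le_one θ]

lemma abs_forcing_le (n : ℕ) {μ C : ℝ} (hμ : 0 < μ) (hC : 0 < C) (θ L : ℝ) :
    |2 * μ * F n θ * (1 - exp (-L) * cos θ) * profile n C (exp (-L))| ≤
      2 * μ * √n * ((1 + exp (-L)) * profile n C (exp (-L))) := by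
  have h := profile_pos n hC (exp_pos (-L))
  have hF : 0 ≤ F n θ := Real.sqrt_nonneg _
  rw [abs_mul, abs_mul, abs_of_nonneg (by positivity : 0 ≤ 2 * μ * F n θ), abs_of_pos h, ← mul_assoc]
  gcongr
  · exact F_le n θ
  · exact abs_one_sub_exp_mul_cos_le θ L

lemma contDiff_rescaledField {n : ℕ} (hn : 1 ≤ n) (μ : ℝ) {C : ℝ} (hC : 0 < C) :
    ContDiff ℝ 1 (rescaledField n μ C) := by
  have hF := contDiff_F hn
  have hp := contDiff_profile n hC
  unfold rescaledField
  fun_prop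

lemma one_sub_cos_pow_le_one (n : ℕ) (θ : ℝ) : 1 - cos θ ^ (2 * n) ≤ 1 := by
  rw [pow_mul]
  linarith [pow_nonneg (sq_nonneg (cos θ)) n]

lemma norm_rescaledField_le {n : ℕ} (hn : 1 ≤ n) {μ C : ℝ} (hμ : 0 < μ) (hC : 0 < C) (p : ℝ × ℝ) :
    ‖rescaledField n μ C p‖ ≤ n + 2 * μ * √n * (1 / √C + 2) := by
  obtain ⟨θ, L⟩ := p
  have h1 := abs_forcing_le n hμ hC θ L
  have h2 : (1 + exp (-L)) * profile n C (exp (-L)) ≤ 1 / √C + 2 := by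
    have := profile_le hn hC (exp_pos (-L)).le
    have := mul_profile_le_one hn hC (exp (-L))
    linarith
  have h3 : 2 * μ * √n * ((1 + exp (-L)) * profile n C (exp (-L))) ≤
      2 * μ * √n * (1 / √C + 2) := by gcongr
  have h4 : |F n θ ^ 2 * (sin θ * cos θ)| ≤ n := by
    have hF : 0 ≤ F n θ := Real.sqrt_nonneg _
    have hF2 : F n θ ^ 2 ≤ n := by
      calc F n θ ^ 2 ≤ √(n : ℝ) ^ 2 := by gcongr; exact F_le n θ
        _ = (n : ℝ) := sq_sqrt (by positivity)
    rw [abs_mul, abs_mul, abs_of_nonneg (sq_nonneg _)]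
    calc F n θ ^ 2 * (|sin θ| * |cos θ|) ≤ n * (1 * 1) := by
          gcongr
          · exact abs_sin_le_one θ
          · exact abs_cos_le_one θ
      _ = (n : ℝ) := by ring
  rw [Prod.norm_def, max_le_iff]
  simp only [rescaledField, Real.norm_eq_abs]
  constructor
  · refine (abs_sub _ _).trans ?_
    rw [abs_neg]
    linarith
  · rw [abs_of_nonneg (one_sub_cos_pow_nonneg n θ)]
    have h5 : (1 : ℝ) ≤ n := by exact_mod_cast hn
    have h6 : 0 ≤ 2 * μ * √n * (1 / √C + 2) := by positivity
    linarith [one_sub_cos_pow_le_one n θ]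

lemma exists_rescaled_solution {n : ℕ} (hn : 1 ≤ n) {μ C : ℝ} (hμ : 0 < μ) (hC : 0 < C)
    (p₀ : ℝ × ℝ) :
    ∃ p : ℝ → ℝ × ℝ, p 0 = p₀ ∧ ∀ τ, HasDerivAt p (rescaledField n μ C (p τ)) τ :=
  exists_global_solution (contDiff_rescaledField hn μ hC).locallyLipschitz
    (norm_rescaledField_le hn hμ hC) p₀

/-- The parametrization `(θ, L) ↦ (θ, T, Q)` of the surface carrying `rescaledField`. -/
def surface (n : ℕ) (C : ℝ) (p : ℝ × ℝ) : ℝ × ℝ × ℝ :=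
  (p.1, (1 + exp (-p.2))⁻¹, √(1 + C * exp (2 * n * p.2)))

lemma sqrt_pow_add_eq (n : ℕ) (C L : ℝ) :
    √(exp (-L) ^ (2 * n) + C) = √(1 + C * exp (2 * n * L)) * exp (-L) ^ n := by
  have h : exp (2 * n * L) * (exp (-L) ^ n) ^ 2 = 1 := by
    rw [← Real.exp_nat_mul, ← Real.exp_nat_mul, ← Real.exp_add, Real.exp_eq_one_iff]
    push_cast
    ring
  conv_rhs => rw [← Real.sqrt_sq (by positivity : 0 ≤ exp (-L) ^ n)]
  rw [← Real.sqrt_mul' _ (sq_nonneg _)]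
  congr 1
  rw [mul_comm 2 n, pow_mul]
  linear_combination -C * h

/-- Solutions of `rescaledField` are mapped to solutions of `X10` by `surface`, up to the clock. -/
lemma hasDerivAt_surface {n : ℕ} (hn : 1 ≤ n) {μ C : ℝ} (hC : 0 < C) {p : ℝ → ℝ × ℝ} {τ : ℝ}
    (hp : HasDerivAt p (rescaledField n μ C (p τ)) τ) :
    HasDerivAt (fun τ => surface n C (p τ))
      (clock n C (p τ).2 • X10 n μ (surface n C (p τ))) τ := by
  have h1 : HasDerivAt (fun τ => (p τ).1) (rescaledField n μ C (p τ)).1 τ := hp.fst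
  have h2 : HasDerivAt (fun τ => (p τ).2) (rescaledField n μ C (p τ)).2 τ := hp.snd
  have hE : HasDerivAt (fun τ => 1 + exp (-(p τ).2)) _ τ := h2.fun_neg.exp.const_add 1
  have hT : HasDerivAt (fun τ => (1 + exp (-(p τ).2))⁻¹) _ τ := hE.fun_inv (by positivity)
  have hQ : HasDerivAt (fun τ => √(1 + C * exp (2 * n * (p τ).2))) _ τ :=
    (((h2.const_mul (2 * n : ℝ)).exp.const_mul C).const_add 1).sqrt (by positivity)
  have hn0 : (0 : ℝ) < n := by exact_mod_cast hn
  have hr := sqrt_pow_add_eq n C (p τ).2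
  have hQpos : 0 < √(1 + C * exp (2 * n * (p τ).2)) := by positivity
  have hQsq : √(1 + C * exp (2 * n * (p τ).2)) ^ 2 = 1 + C * exp (2 * n * (p τ).2) :=
    sq_sqrt (by positivity)
  have he := exp_pos (-(p τ).2)
  have hx : exp (-(p τ).2) ^ n = exp (-(p τ).2) ^ (n - 1) * exp (-(p τ).2) :=
    (pow_sub_one_mul (by omega) _).symm
  have hxpos : 0 < exp (-(p τ).2) ^ (n - 1) := by positivity
  refine (h1.prodMk (hT.prodMk hQ)).congr_deriv ?_
  ext
  · simp only [surface, clock, profile, Prod.smul_fst, smul_eq_mul, X10_fst_eq hn, rescaledField,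
      hr, hx]
    generalize √(1 + C * exp (2 * n * (p τ).2)) = Q at *
    generalize exp (-(p τ).2) ^ (n - 1) = x at *
    generalize exp (-(p τ).2) = e at *
    field_simp
    ring
  · simp only [surface, clock, profile, Prod.smul_fst, Prod.smul_snd, smul_eq_mul, X10_snd_fst_eq,
      rescaledField, hr, hx]
    generalize √(1 + C * exp (2 * n * (p τ).2)) = Q at *
    generalize exp (-(p τ).2) ^ (n - 1) = x at *
    generalize exp (-(p τ).2) = e at *
    simp
    field_simp
    ring
  · simp only [surface, clock, profile, Prod.smul_snd, smul_eq_mul, X10, rescaledField, hr, hx, hQsq]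
    generalize √(1 + C * exp (2 * n * (p τ).2)) = Q at *
    generalize exp (-(p τ).2) ^ (n - 1) = x at *
    generalize exp (-(p τ).2) = e at *
    simp
    field_simp
    ring

lemma exists_clock_integral (n : ℕ) {C : ℝ} (hC : 0 < C) {L : ℝ → ℝ} (hL : Continuous L) :
    ∃ h : ℝ → ℝ, h 0 = 0 ∧ ∀ τ, HasDerivAt h (clock n C (L τ)) τ :=
  ⟨fun τ => ∫ s in (0 : ℝ)..τ, clock n C (L s), by simp, fun τ =>
    ((continuous_clock n hC).comp hL).integral_hasStrictDerivAt 0 τ |>.hasDerivAt⟩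

lemma monotone_snd_of_rescaled {n : ℕ} {μ C : ℝ} {p : ℝ → ℝ × ℝ}
    (hp : ∀ τ, HasDerivAt p (rescaledField n μ C (p τ)) τ) : Monotone fun τ => (p τ).2 :=
  monotone_of_hasDerivAt_nonneg (fun τ => (hp τ).snd) fun _ => one_sub_cos_pow_nonneg n _

lemma exists_solution_of_clock_tendsto {n : ℕ} (hn : 1 ≤ n) {μ C : ℝ} (hC : 0 < C)
    {p : ℝ → ℝ × ℝ} (hp : ∀ τ, HasDerivAt p (rescaledField n μ C (p τ)) τ) {h : ℝ → ℝ}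
    (h0 : h 0 = 0) (hh : ∀ τ, HasDerivAt h (clock n C (p τ).2) τ) (htop : Tendsto h atTop atTop) :
    ∃ γ : ℝ → ℝ × ℝ × ℝ, γ 0 = surface n C (p 0) ∧ ∀ t, HasDerivAt γ (X10 n μ (γ t)) t := by
  have hn0 : (0 : ℝ) < n := by exact_mod_cast hn
  have hmono : StrictMono h := strictMono_of_hasDerivAt_pos hh fun τ => clock_pos hn hC _
  have hcont : Continuous h := continuous_iff_continuousAt.2 fun τ => (hh τ).continuousAt
  have hbot : Tendsto h atBot atBot := by
    set m₀ : ℝ := n / 3 * (exp (-(p 0).2) ^ n / √(exp (-(p 0).2) ^ (2 * n) + C))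
    have hm₀ : 0 < m₀ := by
      have := sqrt_pow_add_pos (n := n) (e := exp (-(p 0).2)) hC
      positivity
    have hlin : ∀ τ ≤ 0, h τ ≤ m₀ * τ := by
      intro τ hτ
      have := le_add_mul_of_deriv_le (f := fun t => h (-t)) (a := 0) (c := 0) (d := -m₀) (t := -τ)
        (f' := fun t => -clock n C (p (-t)).2)
        (fun t _ => by simpa using! (hh (-t)).comp t (hasDerivAt_neg t))
        (by simp [h0]) (fun t ht _ => neg_le_neg (le_clock hn hC
          (monotone_snd_of_rescaled hp (by simpa using ht)))) (by simpa using hτ)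
      simpa using this
    refine tendsto_atBot_mono' _ ?_ (tendsto_id.const_mul_atBot hm₀)
    filter_upwards [eventually_le_atBot 0] with τ hτ using hlin τ hτ
  let e := hmono.orderIsoOfSurjective h (hcont.surjective htop hbot)
  have he : ∀ t, h (e.symm t) = t := fun t => e.apply_symm_apply t
  have hd : ∀ t, HasDerivAt (fun t => e.symm t) (clock n C (p (e.symm t)).2)⁻¹ t := fun t =>
    HasDerivAt.of_local_left_inverse e.symm.continuous.continuousAt (hh _) (clock_pos hn hC _).ne'
      (.of_forall he)
  refine ⟨fun t => surface n C (p (e.symm t)), ?_, fun t => ?_⟩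
  · have : e.symm 0 = 0 := hmono.injective (by rw [he, h0])
    simp only [this]
  · have := (hasDerivAt_surface hn hC (hp (e.symm t))).scomp t (hd t)
    rwa [inv_smul_smul₀ (clock_pos hn hC _).ne'] at this

lemma tendsto_snd_atTop {n : ℕ} (hn : 1 ≤ n) {μ C : ℝ} (hC : 0 < C)
    {p : ℝ → ℝ × ℝ} (hp : ∀ τ, HasDerivAt p (rescaledField n μ C (p τ)) τ) {h : ℝ → ℝ} {H : ℝ}
    (hh : ∀ τ, HasDerivAt h (clock n C (p τ).2) τ) (hH : Tendsto h atTop (nhds H)) :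
    Tendsto (fun τ => (p τ).2) atTop atTop := by
  have hn0 : (0 : ℝ) < n := by exact_mod_cast hn
  have hL := monotone_snd_of_rescaled hp
  refine (tendsto_atTop_of_monotone hL).resolve_right ?_
  rintro ⟨l, hl⟩
  have hle : ∀ τ, (p τ).2 ≤ l := fun τ => hL.ge_of_tendsto hl τ
  set m₀ : ℝ := n / 3 * (exp (-l) ^ n / √(exp (-l) ^ (2 * n) + C))
  have hm₀ : 0 < m₀ := by
    have := sqrt_pow_add_pos (n := n) (e := exp (-l)) hC
    positivity
  have hlin : ∀ τ, 0 ≤ τ → h 0 + m₀ * τ ≤ h τ := by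
    intro τ hτ
    have := le_add_mul_of_deriv_le (a := 0) (c := -h 0) (d := -m₀) (fun t _ => (hh t).neg)
      le_rfl (fun t _ _ => neg_le_neg (le_clock hn hC (hle t))) hτ
    simp only [Pi.neg_apply, sub_zero] at this
    linarith
  have htop : Tendsto h atTop atTop := by
    refine tendsto_atTop_mono' _ ?_
      (tendsto_atTop_add_const_left _ (h 0) (tendsto_id.const_mul_atTop hm₀))
    filter_upwards [eventually_ge_atTop 0] with τ hτ using hlin τ hτ
  exact not_tendsto_nhds_of_tendsto_atTop htop H hH

lemma hasDerivAt_exp_mul_cos {n : ℕ} {μ C : ℝ} {p : ℝ → ℝ × ℝ} {τ : ℝ}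
    (hp : HasDerivAt p (rescaledField n μ C (p τ)) τ) :
    HasDerivAt (fun τ => exp (-(p τ).2) * cos (p τ).1)
      (exp (-(p τ).2) * sin (p τ).1 * (2 * μ * F n (p τ).1 * (1 - exp (-(p τ).2) * cos (p τ).1) *
        profile n C (exp (-(p τ).2)))) τ := by
  have h1 : HasDerivAt (fun τ => (p τ).1) (rescaledField n μ C (p τ)).1 τ := hp.fst
  have h2 : HasDerivAt (fun τ => (p τ).2) (rescaledField n μ C (p τ)).2 τ := hp.snd
  refine (h2.fun_neg.exp.mul h1.cos).congr_deriv ?_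
  have hs := one_sub_cos_pow n (p τ).1
  rw [← sin_sq] at hs
  simp only [rescaledField]
  linear_combination exp (-(p τ).2) * cos (p τ).1 * hs

lemma tendsto_cos_zero {n : ℕ} (hn : 1 ≤ n) {μ C : ℝ} (hμ : 0 < μ) (hC : 0 < C)
    {p : ℝ → ℝ × ℝ} (hp : ∀ τ, HasDerivAt p (rescaledField n μ C (p τ)) τ) {h : ℝ → ℝ} {H : ℝ}
    (hh : ∀ τ, HasDerivAt h (clock n C (p τ).2) τ) (hH : Tendsto h atTop (nhds H)) :
    Tendsto (fun τ => cos (p τ).1) atTop (nhds 0) := by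
  have hn0 : (0 : ℝ) < n := by exact_mod_cast hn
  have hL := tendsto_snd_atTop hn hC hp hh hH
  have hLm := monotone_snd_of_rescaled hp
  set K : ℝ := 2 * μ * √n * (3 / n)
  have hbound : ∀ σ : ℝ, |σ| = 1 → ∀ τ₀, -σ * cos (p τ₀).1 ≤ K * (H - h τ₀) := by
    intro σ hσ τ₀
    have he₀ := exp_pos (-(p τ₀).2)
    have hdec : ∀ τ, τ₀ ≤ τ →
        σ * (exp (-(p τ).2) * cos (p τ).1) - exp (-(p τ₀).2) * K * h τ ≤
          σ * (exp (-(p τ₀).2) * cos (p τ₀).1) - exp (-(p τ₀).2) * K * h τ₀ := by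
      intro τ hτ
      refine le_of_deriv_nonpos_above (a := τ₀) (f := fun τ =>
          σ * (exp (-(p τ).2) * cos (p τ).1) - exp (-(p τ₀).2) * K * h τ)
        (fun t _ => ((hasDerivAt_exp_mul_cos (hp t)).const_mul σ).sub ((hh t).const_mul _))
        le_rfl (fun t ht _ => ?_) hτ
      rw [sub_nonpos]
      refine (le_abs_self _).trans ?_
      rw [abs_mul, hσ, one_mul, abs_mul, abs_mul, abs_of_pos (exp_pos _)]
      have h1 := abs_forcing_le n hμ hC (p t).1 (p t).2
      have h2 : 2 * μ * √n * ((1 + exp (-(p t).2)) * profile n C (exp (-(p t).2))) =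
          K * clock n C (p t).2 := by
        simp only [K, clock]
        field_simp
      rw [h2] at h1
      have h3 : exp (-(p t).2) ≤ exp (-(p τ₀).2) := exp_le_exp.2 (neg_le_neg (hLm ht))
      calc _ ≤ exp (-(p τ₀).2) * 1 * (K * clock n C (p t).2) := by
            gcongr
            exact abs_sin_le_one _
        _ = _ := by ring
    have hexp : Tendsto (fun τ => exp (-(p τ).2)) atTop (nhds 0) :=
      tendsto_exp_neg_atTop_nhds_zero.comp hL
    have hlim : Tendsto (fun τ => σ * (exp (-(p τ).2) * cos (p τ).1) -
        exp (-(p τ₀).2) * K * h τ) atTop (nhds (σ * 0 - exp (-(p τ₀).2) * K * H)) := by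
      refine ((squeeze_zero_norm (fun τ => ?_) hexp).const_mul σ).sub (hH.const_mul _)
      rw [Real.norm_eq_abs, abs_mul, abs_of_pos (exp_pos _)]
      exact mul_le_of_le_one_right (exp_pos _).le (abs_cos_le_one _)
    have := le_of_tendsto hlim (by filter_upwards [eventually_ge_atTop τ₀] with τ hτ using hdec τ hτ)
    refine le_of_mul_le_mul_left ?_ he₀
    linarith
  refine squeeze_zero_norm (a := fun τ => K * (H - h τ)) (fun τ => ?_) ?_
  · rw [Real.norm_eq_abs, abs_le']
    have h1 := hbound 1 (by simp) τ
    have h2 := hbound (-1) (by simp) τ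
    constructor <;> linarith
  · simpa using (hH.const_sub H).const_mul K

lemma eventually_sign_sin {θ : ℝ → ℝ} (hθ : Continuous θ)
    (h : Tendsto (fun τ => cos (θ τ)) atTop (nhds 0)) :
    (∀ᶠ τ in atTop, 0 < sin (θ τ)) ∨ ∀ᶠ τ in atTop, sin (θ τ) < 0 := by
  obtain ⟨τ₀, hτ₀⟩ := eventually_atTop.1 (h.eventually (Ioo_mem_nhds neg_one_lt_zero one_pos))
  have hne : ∀ τ ∈ Set.Ici τ₀, sin (θ τ) ≠ 0 := by
    intro τ hτ h0
    have h1 := sin_sq_add_cos_sq (θ τ)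
    have h2 := hτ₀ τ hτ
    rw [h0] at h1
    nlinarith [h2.1, h2.2]
  rcases lt_or_gt_of_ne (hne τ₀ Set.self_mem_Ici) with h0 | h0
  · right
    filter_upwards [eventually_ge_atTop τ₀] with τ hτ
    by_contra! hcon
    obtain ⟨s, hs, hs0⟩ := isPreconnected_Ici.intermediate_value (Set.self_mem_Ici) hτ
      (continuous_sin.comp hθ).continuousOn ⟨h0.le, hcon⟩
    exact hne s hs hs0
  · left
    filter_upwards [eventually_ge_atTop τ₀] with τ hτ
    by_contra! hcon
    obtain ⟨s, hs, hs0⟩ := isPreconnected_Ici.intermediate_value hτ (Set.self_mem_Ici)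
      (continuous_sin.comp hθ).continuousOn ⟨hcon, h0.le⟩
    exact hne s hs hs0

/-- Two trajectories that stay near a planar saddle and start at the same height coincide
initially: the stable set is a graph. -/
lemma fst_eq_of_forall_near_saddle {W : ℝ × ℝ → ℝ × ℝ} {A : ℝ × ℝ →L[ℝ] ℝ × ℝ} {b : ℝ}
    (hW : HasStrictFDerivAt W A 0) (hA : ∀ x y, A (x, y) = (x + b * y, -y)) :
    ∃ η > 0, ∀ p q : ℝ → ℝ × ℝ, (∀ t, 0 ≤ t → HasDerivAt p (W (p t)) t) →
      (∀ t, 0 ≤ t → HasDerivAt q (W (q t)) t) → (∀ t, 0 ≤ t → ‖p t‖ < η) →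
      (∀ t, 0 ≤ t → ‖q t‖ < η) → (p 0).2 = (q 0).2 → (p 0).1 = (q 0).1 := by
  set M : ℝ := b ^ 2 + 1
  have hM : 1 ≤ M := by simp only [M]; nlinarith [sq_nonneg b]
  set ε : ℝ := 1 / (8 * (1 + M))
  have hε : 0 < ε := by positivity
  have hεM : ε * (8 * (1 + M)) = 1 := by simp only [ε]; field_simp
  have hev := hW.isLittleO.bound hε
  obtain ⟨η, hη, hball⟩ := Metric.eventually_nhds_iff.1 hev
  refine ⟨η, hη, fun p q hp hq hpη hqη h0 => ?_⟩
  have hp1 : ∀ t, 0 ≤ t → HasDerivAt (fun t => (p t).1) (W (p t)).1 t := fun t ht => (hp t ht).fst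
  have hp2 : ∀ t, 0 ≤ t → HasDerivAt (fun t => (p t).2) (W (p t)).2 t := fun t ht => (hp t ht).snd
  have hq1 : ∀ t, 0 ≤ t → HasDerivAt (fun t => (q t).1) (W (q t)).1 t := fun t ht => (hq t ht).fst
  have hq2 : ∀ t, 0 ≤ t → HasDerivAt (fun t => (q t).2) (W (q t)).2 t := fun t ht => (hq t ht).snd
  have hG : ∀ t, 0 ≤ t → HasDerivAt
      (fun t => ((p t).1 - (q t).1) ^ 2 - M * ((p t).2 - (q t).2) ^ 2) _ t := fun t ht =>
    (((hp1 t ht).fun_sub (hq1 t ht)).fun_pow 2).sub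
      ((((hp2 t ht).fun_sub (hq2 t ht)).fun_pow 2).const_mul M)
  have hgrow : ∀ t, 0 ≤ t → (((p t).1 - (q t).1) ^ 2 + ((p t).2 - (q t).2) ^ 2) / 2 ≤
      2 * ((p t).1 - (q t).1) * ((W (p t)).1 - (W (q t)).1) -
        M * (2 * ((p t).2 - (q t).2) * ((W (p t)).2 - (W (q t)).2)) := by
    intro t ht
    have h := hball (y := (p t, q t)) (by
      rw [dist_eq_norm, Prod.norm_def]
      simpa using ⟨hpη t ht, hqη t ht⟩)
    simp only at h
    have hAe : A (p t - q t) = ((p t).1 - (q t).1 + b * ((p t).2 - (q t).2),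
        -((p t).2 - (q t).2)) := hA _ _
    rw [hAe, Prod.norm_def, Prod.norm_def, max_le_iff] at h
    simp only [Prod.fst_sub, Prod.snd_sub, Real.norm_eq_abs] at h
    generalize (p t).1 - (q t).1 = D at *
    generalize (p t).2 - (q t).2 = Λ at *
    generalize (W (p t)).1 - (W (q t)).1 = U at *
    generalize (W (p t)).2 - (W (q t)).2 = V at *
    have hmax : max |D| |Λ| ≤ |D| + |Λ| := max_le_add_of_nonneg (abs_nonneg _) (abs_nonneg _)
    have hr1 : |U - (D + b * Λ)| ≤ ε * (|D| + |Λ|) := h.1.trans (by gcongr)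
    have hr2 : |V - -Λ| ≤ ε * (|D| + |Λ|) := h.2.trans (by gcongr)
    have e1 : |D * (U - (D + b * Λ))| ≤ |D| * (ε * (|D| + |Λ|)) := by
      rw [abs_mul]; gcongr
    have e2 : |Λ * (V - -Λ)| ≤ |Λ| * (ε * (|D| + |Λ|)) := by
      rw [abs_mul]; gcongr
    have e3 : (|D| + |Λ|) ^ 2 ≤ 2 * (D ^ 2 + Λ ^ 2) := by
      rw [← sq_abs D, ← sq_abs Λ]; nlinarith [sq_nonneg (|D| - |Λ|)]
    have e4 := (abs_le.1 e1).1
    have e6 : M * (Λ * (V - -Λ)) ≤ M * (|Λ| * (ε * (|D| + |Λ|))) :=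
      mul_le_mul_of_nonneg_left (abs_le.1 e2).2 (by positivity)
    have e7 : |D| * (ε * (|D| + |Λ|)) + M * (|Λ| * (ε * (|D| + |Λ|))) ≤
        ε * (1 + M) * (|D| + |Λ|) ^ 2 := by
      have : 0 ≤ ε * (|D| + |Λ|) * (M * |D| + |Λ|) := by positivity
      linarith
    have e8 : ε * (1 + M) * (|D| + |Λ|) ^ 2 ≤ (D ^ 2 + Λ ^ 2) / 4 := by
      have : ε * (1 + M) = 1 / 8 := by linarith
      rw [this]; linarith
    have e9 : M = b ^ 2 + 1 := rfl
    have e10 : M * Λ ^ 2 = b ^ 2 * Λ ^ 2 + Λ ^ 2 := by rw [e9]; ring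
    nlinarith [sq_nonneg (D + b * Λ), sq_nonneg (b * Λ)]
  by_contra hne
  set G₀ : ℝ := ((p 0).1 - (q 0).1) ^ 2
  have hG₀ : 0 < G₀ := by
    have : (p 0).1 - (q 0).1 ≠ 0 := sub_ne_zero.2 hne
    positivity
  have hinit : -(((p 0).1 - (q 0).1) ^ 2 - M * ((p 0).2 - (q 0).2) ^ 2) ≤ -G₀ := by
    rw [h0]; simp [G₀]
  have hlow : ∀ t, 0 ≤ t → G₀ ≤ ((p t).1 - (q t).1) ^ 2 - M * ((p t).2 - (q t).2) ^ 2 := by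
    intro t ht
    have := le_of_deriv_nonpos_above (a := 0) (c := -G₀) (fun t ht => (hG t ht).neg) hinit
      (fun s hs _ => by
        have h1 := hgrow s hs
        have h2 : 0 ≤ ((p s).1 - (q s).1) ^ 2 + ((p s).2 - (q s).2) ^ 2 := by positivity
        norm_num
        linarith) ht
    simp only [Pi.neg_apply] at this
    linarith
  have hlin : ∀ t, 0 ≤ t → G₀ + G₀ / 2 * t ≤
      ((p t).1 - (q t).1) ^ 2 - M * ((p t).2 - (q t).2) ^ 2 := by
    intro t ht
    have := le_add_mul_of_deriv_le (a := 0) (c := -G₀) (d := -(G₀ / 2))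
      (fun t ht => (hG t ht).neg) hinit
      (fun s hs _ => by
        have h1 := hgrow s hs
        have h2 := hlow s hs
        have h3 : 0 ≤ M * ((p s).2 - (q s).2) ^ 2 := by positivity
        have h4 := sq_nonneg ((p s).2 - (q s).2)
        norm_num
        linarith) ht
    simp only [Pi.neg_apply] at this
    linarith
  have hfin := hlin (8 * η ^ 2 / G₀) (by positivity)
  have ha := hpη (8 * η ^ 2 / G₀) (by positivity)
  have hb := hqη (8 * η ^ 2 / G₀) (by positivity)
  have hcalc : G₀ / 2 * (8 * η ^ 2 / G₀) = 4 * η ^ 2 := by field_simp; ring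
  rw [hcalc] at hfin
  generalize 8 * η ^ 2 / G₀ = t at *
  have h1 := abs_lt.1 ((norm_fst_le (p t)).trans_lt ha)
  have h2 := abs_lt.1 ((norm_fst_le (q t)).trans_lt hb)
  have h3 : 0 ≤ M * ((p t).2 - (q t).2) ^ 2 := by positivity
  have h4 : ((p t).1 - (q t).1) ^ 2 ≤ (2 * η) ^ 2 := by
    apply sq_le_sq' <;> linarith [h1.1, h1.2, h2.1, h2.2]
  linarith

/-- The rescaled field in the coordinates `c = cos θ` and `e = exp (-L)`, on the sheet where `sin θ`
has the sign `σ`. -/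
def polarField (n : ℕ) (μ C σ : ℝ) (p : ℝ × ℝ) : ℝ × ℝ :=
  ((1 - p.1 ^ (2 * n)) * p.1
      + σ * √(1 - p.1 ^ (2 * n)) * (2 * μ * (1 - p.2 * p.1) * profile n C p.2),
    -((1 - p.1 ^ (2 * n)) * p.2))

lemma exists_hasStrictFDerivAt_polarField {n : ℕ} (hn : 1 ≤ n) (μ : ℝ) {C : ℝ} (hC : 0 < C)
    (σ : ℝ) : ∃ (A : ℝ × ℝ →L[ℝ] ℝ × ℝ) (b : ℝ), HasStrictFDerivAt (polarField n μ C σ) A 0 ∧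
      ∀ x y, A (x, y) = (x + b * y, -y) := by
  have hn0 : n ≠ 0 := by omega
  have hW : ContDiffAt ℝ 1 (polarField n μ C σ) 0 := by
    have hp := contDiff_profile n hC
    have hs : ContDiffAt ℝ 1 (fun p : ℝ × ℝ => √(1 - p.1 ^ (2 * n))) 0 :=
      ContDiffAt.sqrt (by fun_prop) (by simp [hn0])
    unfold polarField
    fun_prop
  obtain ⟨A, hA⟩ : ∃ A, HasStrictFDerivAt (polarField n μ C σ) A 0 :=
    ⟨_, hW.hasStrictFDerivAt one_ne_zero⟩
  have hpow : HasDerivAt (fun x : ℝ => 1 - x ^ (2 * n)) 0 0 := by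
    have := (hasDerivAt_pow (2 * n) (0 : ℝ)).const_sub 1
    rwa [zero_pow (by omega), mul_zero, neg_zero] at this
  have hx : A (1, 0) = (1, 0) := by
    have h1 : HasDerivAt (fun x : ℝ => polarField n μ C σ (x, 0)) (A (1, 0)) 0 :=
      hA.hasFDerivAt.comp_hasDerivAt (0 : ℝ) (f := fun x : ℝ => (x, (0 : ℝ)))
        ((hasDerivAt_id (0 : ℝ)).prodMk (hasDerivAt_const (0 : ℝ) (0 : ℝ)))
    have h2 : HasDerivAt (fun x : ℝ => polarField n μ C σ (x, 0)) (1, 0) 0 := by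
      have hsq := hpow.sqrt (by simp [hn0])
      have h3 := (hpow.mul (hasDerivAt_id (0 : ℝ))).add
        ((hsq.const_mul σ).mul_const (2 * μ * profile n C 0))
      refine (h3.prodMk (hasDerivAt_const (0 : ℝ) (0 : ℝ))).congr_deriv ?_ |>.congr_of_eventuallyEq
        (.of_forall fun x => ?_)
      · simp [hn0]
      · simp [polarField]
    exact h1.unique h2
  have hy : (A (0, 1)).2 = -1 := by
    have h1 : HasDerivAt (fun y : ℝ => (polarField n μ C σ (0, y)).2) (A (0, 1)).2 0 :=
      (hA.hasFDerivAt.comp_hasDerivAt (0 : ℝ) (f := fun y : ℝ => ((0 : ℝ), y))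
        ((hasDerivAt_const (0 : ℝ) (0 : ℝ)).prodMk (hasDerivAt_id (0 : ℝ)))).snd
    have h2 : HasDerivAt (fun y : ℝ => (polarField n μ C σ (0, y)).2) (-1) 0 := by
      simpa [polarField, hn0] using! hasDerivAt_neg (0 : ℝ)
    exact h1.unique h2
  refine ⟨A, (A (0, 1)).1, hA, fun x y => ?_⟩
  have : ((x, y) : ℝ × ℝ) = x • (1, 0) + y • (0, 1) := by simp
  rw [this, map_add, map_smul, map_smul, hx]
  ext
  · simp [mul_comm]
  · simp [hy]

lemma hasDerivAt_polar {n : ℕ} {μ C σ : ℝ} {p : ℝ → ℝ × ℝ} {τ : ℝ}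
    (hp : HasDerivAt p (rescaledField n μ C (p τ)) τ) (hσ : sin (p τ).1 = σ * |sin (p τ).1|) :
    HasDerivAt (fun τ => (cos (p τ).1, exp (-(p τ).2)))
      (polarField n μ C σ (cos (p τ).1, exp (-(p τ).2))) τ := by
  have h1 : HasDerivAt (fun τ => (p τ).1) (rescaledField n μ C (p τ)).1 τ := hp.fst
  have h2 : HasDerivAt (fun τ => (p τ).2) (rescaledField n μ C (p τ)).2 τ := hp.snd
  have hs := one_sub_cos_pow n (p τ).1
  rw [← sin_sq] at hs
  have hF : 0 ≤ F n (p τ).1 := Real.sqrt_nonneg _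
  have hsqrt : σ * √(1 - cos (p τ).1 ^ (2 * n)) = F n (p τ).1 * sin (p τ).1 := by
    rw [← hs, ← mul_pow, Real.sqrt_sq_eq_abs, abs_mul, abs_of_nonneg hF]
    linear_combination -F n (p τ).1 * hσ
  refine (h1.cos.prodMk h2.fun_neg.exp).congr_deriv ?_
  ext
  · simp only [polarField, rescaledField, hsqrt]
    linear_combination cos (p τ).1 * hs
  · simp only [polarField, rescaledField]
    ring

lemma rescaledField_add_int_mul_two_pi (n : ℕ) (μ C : ℝ) (p : ℝ × ℝ) (k : ℤ) :
    rescaledField n μ C (p + (k * (2 * π), 0)) = rescaledField n μ C p := by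
  simp [rescaledField, F]

/-- On a fixed sheet at most one of the initial angles in `(0, 1)` leads to `cos θ → 0`. -/
lemma false_of_two_tendsto_cos_zero {n : ℕ} (hn : 1 ≤ n) {μ C : ℝ} (hC : 0 < C) {α β L₀ σ : ℝ}
    (hα : 0 < α) (hαβ : α < β) (hβ : β < 1) {p q : ℝ → ℝ × ℝ}
    (hp0 : p 0 = (α, L₀)) (hq0 : q 0 = (β, L₀))
    (hp : ∀ τ, HasDerivAt p (rescaledField n μ C (p τ)) τ)
    (hq : ∀ τ, HasDerivAt q (rescaledField n μ C (q τ)) τ)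
    (hpL : Tendsto (fun τ => (p τ).2) atTop atTop) (hqL : Tendsto (fun τ => (q τ).2) atTop atTop)
    (hpc : Tendsto (fun τ => cos (p τ).1) atTop (nhds 0))
    (hqc : Tendsto (fun τ => cos (q τ).1) atTop (nhds 0))
    (hpσ : ∀ᶠ τ in atTop, sin (p τ).1 = σ * |sin (p τ).1|)
    (hqσ : ∀ᶠ τ in atTop, sin (q τ).1 = σ * |sin (q τ).1|) : False := by
  obtain ⟨A, b, hA, hAb⟩ := exists_hasStrictFDerivAt_polarField hn μ hC σ
  obtain ⟨η, hη, hsaddle⟩ := fst_eq_of_forall_near_saddle hA hAb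
  have hnear : ∀ r : ℝ → ℝ × ℝ, Tendsto (fun τ => (r τ).2) atTop atTop →
      Tendsto (fun τ => cos (r τ).1) atTop (nhds 0) →
      ∀ᶠ τ in atTop, ‖(cos (r τ).1, exp (-(r τ).2))‖ < η := by
    intro r hrL hrc
    have h := (hrc.prodMk_nhds (tendsto_exp_neg_atTop_nhds_zero.comp hrL)).norm
    simp only [Prod.mk_zero_zero, norm_zero] at h
    exact h.eventually_lt_const hη
  have hcont : ∀ r : ℝ → ℝ × ℝ, (∀ τ, HasDerivAt r (rescaledField n μ C (r τ)) τ) →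
      Continuous r := fun r hr => continuous_iff_continuousAt.2 fun τ => (hr τ).continuousAt
  obtain ⟨τp, hτp⟩ := eventually_atTop.1 ((hnear p hpL hpc).and hpσ)
  obtain ⟨τq, hτq⟩ := eventually_atTop.1 ((hnear q hqL hqc).and hqσ)
  obtain ⟨τ₁, hτ₁, hℓ₁⟩ := isPreconnected_Ici.intermediate_value_Ici
    (Set.self_mem_Ici (a := τp)) (le_principal_iff.2 (Ici_mem_atTop τp))
    (continuous_snd.comp (hcont p hp)).continuousOn hpL
    (le_max_left (p τp).2 (q τq).2 : (p τp).2 ≤ max (p τp).2 (q τq).2)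
  obtain ⟨τ₂, hτ₂, hℓ₂⟩ := isPreconnected_Ici.intermediate_value_Ici
    (Set.self_mem_Ici (a := τq)) (le_principal_iff.2 (Ici_mem_atTop τq))
    (continuous_snd.comp (hcont q hq)).continuousOn hqL
    (le_max_right (p τp).2 (q τq).2 : (q τq).2 ≤ max (p τp).2 (q τq).2)
  simp only [Function.comp_apply] at hℓ₁ hℓ₂
  have hLeq : (p τ₁).2 = (q τ₂).2 := hℓ₁.trans hℓ₂.symm
  have hpt : ∀ t, 0 ≤ t → τp ≤ τ₁ + t := fun t ht => by linarith [Set.mem_Ici.1 hτ₁]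
  have hqt : ∀ t, 0 ≤ t → τq ≤ τ₂ + t := fun t ht => by linarith [Set.mem_Ici.1 hτ₂]
  have hcos : cos (p τ₁).1 = cos (q τ₂).1 := by
    have := hsaddle (fun t => (cos (p (τ₁ + t)).1, exp (-(p (τ₁ + t)).2)))
      (fun t => (cos (q (τ₂ + t)).1, exp (-(q (τ₂ + t)).2)))
      (fun t ht => (hasDerivAt_polar (hp _) (hτp _ (hpt t ht)).2).comp_const_add τ₁ t)
      (fun t ht => (hasDerivAt_polar (hq _) (hτq _ (hqt t ht)).2).comp_const_add τ₂ t)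
      (fun t ht => (hτp _ (hpt t ht)).1) (fun t ht => (hτq _ (hqt t ht)).1)
      (by simp [hLeq])
    simpa using this
  have hsin : sin (p τ₁).1 = sin (q τ₂).1 := by
    have habs : |sin (p τ₁).1| = |sin (q τ₂).1| := by
      rw [← sq_eq_sq_iff_abs_eq_abs, sin_sq, sin_sq, hcos]
    rw [(hτp _ hτ₁).2, (hτq _ hτ₂).2, habs]
  obtain ⟨k, hk⟩ := Real.Angle.angle_eq_iff_two_pi_dvd_sub.1 (Real.Angle.cos_sin_inj hcos hsin)
  have heq : p = fun τ => q (τ + (τ₂ - τ₁)) + ((k * (2 * π), 0) : ℝ × ℝ) := by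
    refine eq_of_locallyLipschitz (contDiff_rescaledField hn μ hC).locallyLipschitz (t₀ := τ₁)
      hp (fun τ => ?_) ?_
    · rw [rescaledField_add_int_mul_two_pi]
      exact ((hq _).comp_add_const τ (τ₂ - τ₁)).add_const _
    · rw [add_sub_cancel]
      ext
      · simp; linarith
      · simpa using hLeq
  have h0 := congrFun heq 0
  simp only [hp0, zero_add, Prod.ext_iff, Prod.fst_add, Prod.snd_add, add_zero] at h0
  have hmono := monotone_snd_of_rescaled hq
  have hpos : 0 < (rescaledField n μ C (q 0)).2 := by
    have h1 := sin_sq_le_one_sub_cos_pow hn (q 0).1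
    have h2 : 0 < sin (q 0).1 := by
      rw [hq0]; exact sin_pos_of_pos_of_lt_pi (by simp; linarith) (by simp; linarith [pi_gt_three])
    simp only [rescaledField]
    nlinarith
  have hder : HasDerivAt (fun τ => (q τ).2) (rescaledField n μ C (q 0)).2 0 := (hq 0).snd
  have hend : (q (τ₂ - τ₁)).2 = (q 0).2 := by rw [← h0.2, hq0]
  rcases lt_trichotomy (τ₂ - τ₁) 0 with hlt | hz | hgt
  · have : IsLocalMin (fun τ => (q τ).2) 0 := by
      filter_upwards [Ioi_mem_nhds hlt] with τ hτ
      rw [← hend]; exact hmono (le_of_lt hτ)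
    exact hpos.ne' (this.hasDerivAt_eq_zero hder)
  · rw [hz, hq0] at h0
    have h1 := h0.1
    simp only at h1
    have hπ := pi_gt_three
    rcases le_or_gt 0 k with hk0 | hk0
    · have : (0 : ℝ) ≤ k := by exact_mod_cast hk0
      nlinarith
    · have : (k : ℝ) ≤ -1 := by exact_mod_cast Int.le_sub_one_of_lt hk0
      nlinarith
  · have : IsLocalMax (fun τ => (q τ).2) 0 := by
      filter_upwards [Iio_mem_nhds hgt] with τ hτ
      rw [← hend]; exact hmono (le_of_lt hτ)
    exact hpos.ne' (this.hasDerivAt_eq_zero hder)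

/-- For `Q₀ > 1` solutions may blow up, but arbitrarily close to `θ = 0` some are global. -/
lemma exists_solution_of_one_lt {n : ℕ} (hn : 1 ≤ n) {μ a T₀ Q₀ : ℝ} (hμ : 0 < μ) (ha : 0 < a)
    (ha1 : 3 * a < 1) (hT0 : 0 < T₀) (hT1 : T₀ < 1) (hQ : 1 < Q₀) :
    ∃ θ₀, 0 < θ₀ ∧ θ₀ ≤ 3 * a ∧ ∃ γ : ℝ → ℝ × ℝ × ℝ, γ 0 = (θ₀, T₀, Q₀) ∧
      ∀ t, HasDerivAt γ (X10 n μ (γ t)) t := by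
  obtain ⟨L₀, hL₀⟩ : ∃ L₀, exp (-L₀) = (1 - T₀) / T₀ :=
    ⟨-log ((1 - T₀) / T₀), by rw [neg_neg, exp_log (div_pos (by linarith) hT0)]⟩
  obtain ⟨C, hC, hCeq⟩ : ∃ C, 0 < C ∧ C * exp (2 * n * L₀) = Q₀ ^ 2 - 1 :=
    ⟨(Q₀ ^ 2 - 1) / exp (2 * n * L₀), div_pos (by nlinarith) (exp_pos _),
      div_mul_cancel₀ _ (exp_pos _).ne'⟩
  have hsurf : ∀ θ₀, surface n C (θ₀, L₀) = (θ₀, T₀, Q₀) := by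
    intro θ₀
    have h1 : (1 + (1 - T₀) / T₀)⁻¹ = T₀ := by field_simp; ring
    have h2 : √(1 + (Q₀ ^ 2 - 1)) = Q₀ := by
      rw [add_sub_cancel, Real.sqrt_sq (by linarith)]
    simp only [surface, hL₀, hCeq, h1, h2]
  by_contra! hcon
  have hbad : ∀ θ₀, 0 < θ₀ → θ₀ ≤ 3 * a → ∃ p : ℝ → ℝ × ℝ, p 0 = (θ₀, L₀) ∧
      (∀ τ, HasDerivAt p (rescaledField n μ C (p τ)) τ) ∧
      Tendsto (fun τ => (p τ).2) atTop atTop ∧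
      Tendsto (fun τ => cos (p τ).1) atTop (nhds 0) ∧
      ((∀ᶠ τ in atTop, sin (p τ).1 = 1 * |sin (p τ).1|) ∨
        ∀ᶠ τ in atTop, sin (p τ).1 = -1 * |sin (p τ).1|) := by
    intro θ₀ hθ hθa
    obtain ⟨p, hp0, hp⟩ := exists_rescaled_solution hn hμ hC (θ₀, L₀)
    have hcont : Continuous p := continuous_iff_continuousAt.2 fun τ => (hp τ).continuousAt
    obtain ⟨h, h0, hh⟩ := exists_clock_integral n hC (continuous_snd.comp hcont)
    have hmono : Monotone h := monotone_of_hasDerivAt_nonneg hh fun τ => (clock_pos hn hC _).le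
    rcases tendsto_atTop_of_monotone hmono with htop | ⟨H, hH⟩
    · obtain ⟨γ, hγ0, hγ⟩ := exists_solution_of_clock_tendsto hn hC hp h0 hh htop
      rw [hp0, hsurf] at hγ0
      obtain ⟨t, ht⟩ := hcon θ₀ hθ hθa γ hγ0
      exact absurd (hγ t) ht
    · have hc := tendsto_cos_zero hn hμ hC hp hh hH
      refine ⟨p, hp0, hp, tendsto_snd_atTop hn hC hp hh hH, hc, ?_⟩
      refine (eventually_sign_sin (continuous_fst.comp hcont) hc).imp (fun h => ?_) fun h => ?_
      · filter_upwards [h] with τ hτ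
        rw [one_mul]; exact (abs_of_pos hτ).symm
      · filter_upwards [h] with τ hτ
        have := abs_of_neg hτ
        simp only [Function.comp_apply] at this
        linarith
  obtain ⟨p, hp0, hp, hpL, hpc, hpσ⟩ := hbad a ha (by linarith)
  obtain ⟨q, hq0, hq, hqL, hqc, hqσ⟩ := hbad (2 * a) (by linarith) (by linarith)
  obtain ⟨r, hr0, hr, hrL, hrc, hrσ⟩ := hbad (3 * a) (by linarith) le_rfl
  have hpq : ∀ σ : ℝ, (∀ᶠ τ in atTop, sin (p τ).1 = σ * |sin (p τ).1|) →
      (∀ᶠ τ in atTop, sin (q τ).1 = σ * |sin (q τ).1|) → False := fun σ =>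
    false_of_two_tendsto_cos_zero hn hC ha (by linarith) (by linarith) hp0 hq0 hp hq hpL hqL hpc hqc
  have hpr : ∀ σ : ℝ, (∀ᶠ τ in atTop, sin (p τ).1 = σ * |sin (p τ).1|) →
      (∀ᶠ τ in atTop, sin (r τ).1 = σ * |sin (r τ).1|) → False := fun σ =>
    false_of_two_tendsto_cos_zero hn hC ha (by linarith) ha1 hp0 hr0 hp hr hpL hrL hpc hrc
  have hqr : ∀ σ : ℝ, (∀ᶠ τ in atTop, sin (q τ).1 = σ * |sin (q τ).1|) →
      (∀ᶠ τ in atTop, sin (r τ).1 = σ * |sin (r τ).1|) → False := fun σ =>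
    false_of_two_tendsto_cos_zero hn hC (by linarith) (by linarith) ha1 hq0 hr0 hq hr hqL hrL hqc hrc
  rcases hpσ with h1 | h1 <;> rcases hqσ with h2 | h2 <;> rcases hrσ with h3 | h3 <;>
    first | exact hpq _ h1 h2 | exact hpr _ h1 h3 | exact hqr _ h2 h3

theorem stmt_11 (n : ℕ) (hn : 1 ≤ n) (μ : ℝ) (hμ : 0 < μ) (Qs : ℝ) (hQ0 : Qs ≠ 0) (hQ1 : Qs ≠ 1) (hQm1 : Qs ≠ -1) :
    X10 n μ (0, 1 / 2, Qs) = (0, 0, 0) ∧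
      ¬ LyapunovStable (X10 n μ) (Set.univ : Set (ℝ × ℝ × ℝ)) (0, 1 / 2, Qs) := by
  have hnorm : ∀ θ u δ : ℝ, |θ| < δ → |u| < δ →
      ‖((θ, 1 / 2 + u, Qs) - (0, 1 / 2, Qs) : ℝ × ℝ × ℝ)‖ < δ := by
    intro θ u δ hθ hu
    simp only [Prod.norm_def, Prod.fst_sub, Prod.snd_sub, sub_zero, add_sub_cancel_left, sub_self,
      Real.norm_eq_abs, abs_zero, max_lt_iff]
    exact ⟨hθ, hu, (abs_nonneg θ).trans_lt hθ⟩
  refine ⟨by norm_num [X10], fun hstab => ?_⟩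
  rcases lt_or_gt_of_ne hQ0 with hneg | hpos
  · obtain ⟨ε, hε, hesc⟩ := exists_escape_of_neg hn hμ hneg
    obtain ⟨δ, hδ, hst⟩ := hstab ε hε
    obtain ⟨γ, hγ0, hγ⟩ := exists_solution_of_le_one hn μ (δ / 2) (T₀ := 1 / 2 + 0) (Q₀ := Qs)
      (by norm_num) (by norm_num) (by linarith)
    obtain ⟨t, ht, hle⟩ := hesc γ hγ (by rw [hγ0]; simp only; linarith) (by rw [hγ0]; norm_num)
    refine hle.not_gt (hst γ (fun _ _ => Set.mem_univ _) hγ ?_ t ht)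
    rw [hγ0]
    exact hnorm _ _ _ (by rw [abs_of_pos] <;> linarith) (by simpa using hδ)
  · obtain ⟨ε, hε, hesc⟩ := exists_escape_of_pos hn hμ hpos
    obtain ⟨δ, hδ, hst⟩ := hstab ε hε
    obtain ⟨u, hu, huδ, hu2⟩ : ∃ u > 0, u < δ ∧ 4 * u < 1 :=
      ⟨min (δ / 2) (1 / 8), lt_min (by linarith) (by norm_num),
        (min_le_left _ _).trans_lt (by linarith), by linarith [min_le_right (δ / 2) (1 / 8)]⟩
    obtain ⟨θ₀, γ, hθ₀, hγ0, hγ⟩ : ∃ (θ₀ : ℝ) (γ : ℝ → ℝ × ℝ × ℝ), |θ₀| < δ ∧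
        γ 0 = (θ₀, 1 / 2 + u, Qs) ∧ ∀ t, 0 ≤ t → HasDerivAt γ (X10 n μ (γ t)) t := by
      rcases lt_or_gt_of_ne hQ1 with hlt | hgt
      · obtain ⟨γ, hγ0, hγ⟩ := exists_solution_of_le_one hn μ 0 (T₀ := 1 / 2 + u) (Q₀ := Qs)
          (by linarith) (by linarith) hlt.le
        exact ⟨0, γ, by simpa using hδ, hγ0, hγ⟩
      · obtain ⟨θ₀, hθ, hθu, γ, hγ0, hγ⟩ := exists_solution_of_one_lt hn (a := u / 3)
          (T₀ := 1 / 2 + u) (Q₀ := Qs) hμ (by linarith) (by linarith) (by linarith) (by linarith) hgt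
        exact ⟨θ₀, γ, by rw [abs_of_pos hθ]; linarith, hγ0, fun t _ => hγ t⟩
    obtain ⟨t, ht, hle⟩ := hesc γ hγ (by rw [hγ0]; simp only; linarith)
    refine hle.not_gt (hst γ (fun _ _ => Set.mem_univ _) hγ ?_ t ht)
    rw [hγ0]
    exact hnorm _ _ _ hθ₀ (by rwa [abs_of_pos hu])
end
end

section
/- Let s ∈ ℝ with s ≠ 0. Consider the vector field X on ℝ⁵ in the variables (x₂, x₃, x₄, x, y) given by X(x₂,x₃,x₄,x,y) = ( 2x₂(3x² + x₂ + 2x₃ + 3x₄ − 1), 2x₃(3x² + x₂ + 2x₃ + 3x₄ − 2), 2x₄(3x² + x₂ + 2x₃ + 3x₄ − 3), 3x³ + (x₂ + 2x₃ + 3x₄ − 3)x + √6·s·y², (3x² − √6·s·x + x₂ + 2x₃ + 3x₄)·y ). Then the origin (0,0,0,0,0) is an equilibrium of X and it is locally asymptotically stable: it is Lyapunov stable, and there exists δ > 0 such that every differentiable curve γ : [0,∞) → ℝ⁵ with γ'(t) = X(γ(t)) for all t and ‖γ(0)‖ < δ satisfies γ(t) → 0 as t → ∞. -/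
open Real Filter

noncomputable section

/-- Local asymptotic stability of the equilibrium `p` of the vector field `X` on `D`:
Lyapunov stability together with local attractivity. -/
def LocallyAsympStable {E : Type*} [NormedAddCommGroup E] [NormedSpace ℝ E]
    (X : E → E) (D : Set E) (p : E) : Prop :=
  LyapunovStable X D p ∧
    ∃ δ > 0, ∀ γ : ℝ → E,
      (∀ t : ℝ, 0 ≤ t → γ t ∈ D) →
      (∀ t : ℝ, 0 ≤ t → HasDerivAt γ (X (γ t)) t) →
      ‖γ 0 - p‖ < δ → Filter.Tendsto γ Filter.atTop (nhds p)

/-- The HL vector field beyond detailed balance with exponential potential, in the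
variables `(x₂, x₃, x₄, x, y)`. -/
def X12 (s : ℝ) (p : Fin 5 → ℝ) : Fin 5 → ℝ :=
  ![2 * p 0 * (3 * p 3 ^ 2 + p 0 + 2 * p 1 + 3 * p 2 - 1),
    2 * p 1 * (3 * p 3 ^ 2 + p 0 + 2 * p 1 + 3 * p 2 - 2),
    2 * p 2 * (3 * p 3 ^ 2 + p 0 + 2 * p 1 + 3 * p 2 - 3),
    3 * p 3 ^ 3 + (p 0 + 2 * p 1 + 3 * p 2 - 3) * p 3 + Real.sqrt 6 * s * p 4 ^ 2,
    (3 * p 3 ^ 2 - Real.sqrt 6 * s * p 3 + p 0 + 2 * p 1 + 3 * p 2) * p 4]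

section Lyapunov

variable {E : Type*} [NormedAddCommGroup E] [NormedSpace ℝ E] [ProperSpace E]

/-- A Lyapunov function whose orbital derivative is nonpositive near `p` keeps solutions
starting close to `p` in any prescribed neighbourhood of `p`. -/
theorem LyapunovStable.of_orbital_derivative_nonpos {X : E → E} {V V' : E → ℝ} {p : E} {r : ℝ}
    (hr : 0 < r) (hV : Continuous V)
    (hderiv : ∀ (γ : ℝ → E) (t : ℝ), HasDerivAt γ (X (γ t)) t →
      HasDerivAt (fun τ => V (γ τ)) (V' (γ t)) t)
    (hp : V p = 0) (hpos : ∀ q, q ≠ p → 0 < V q)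
    (hnonpos : ∀ q, ‖q - p‖ < r → V' q ≤ 0) :
    LyapunovStable X Set.univ p := by
  intro ε hε
  obtain ⟨ρ, hρ, hρε, hρr⟩ : ∃ ρ > 0, ρ ≤ ε ∧ ρ ≤ r :=
    ⟨min ε r, lt_min hε hr, min_le_left _ _, min_le_right _ _⟩
  obtain ⟨m, hm, hmin⟩ := (isCompact_sphere p ρ).exists_forall_le' hV.continuousOn
    (a := 0) (fun q hq => hpos q (by
      rintro rfl
      simp at hq
      exact hρ.ne hq))
  obtain ⟨d, hd, hdV⟩ := Metric.eventually_nhds_iff.1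
    ((hV.tendsto p).eventually (gt_mem_nhds (hp.trans_lt hm)))
  refine ⟨min d ρ, lt_min hd hρ, fun γ _ hγ h0 t ht => ?_⟩
  suffices h : ‖γ t - p‖ < ρ from h.trans_le hρε
  by_contra! hcon
  have hcont : ContinuousOn (fun τ => ‖γ τ - p‖) (Set.Ici 0) := fun τ hτ =>
    ((hγ τ hτ).continuousAt.sub continuousAt_const).norm.continuousWithinAt
  -- the first time at which the solution reaches the sphere of radius `ρ`
  have hScl : IsClosed (Set.Icc 0 t ∩ (fun τ => ‖γ τ - p‖) ⁻¹' Set.Ici ρ) :=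
    (hcont.mono Set.Icc_subset_Ici_self).preimage_isClosed_of_isClosed isClosed_Icc isClosed_Ici
  have hScomp : IsCompact (Set.Icc 0 t ∩ (fun τ => ‖γ τ - p‖) ⁻¹' Set.Ici ρ) :=
    isCompact_Icc.of_isClosed_subset hScl Set.inter_subset_left
  obtain ⟨T, ⟨⟨hT0, hTt⟩, hTρ⟩, hTmin⟩ := hScomp.exists_isLeast ⟨t, ⟨ht, le_rfl⟩, hcon⟩
  have hbefore : ∀ τ, 0 ≤ τ → τ < T → ‖γ τ - p‖ < ρ := fun τ h1 h2 => by
    by_contra! h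
    exact absurd (hTmin ⟨⟨h1, h2.le.trans hTt⟩, h⟩) (not_le.2 h2)
  obtain ⟨T', ⟨hT'0, hT'T⟩, hT'ρ⟩ := intermediate_value_Icc hT0
    (hcont.mono Set.Icc_subset_Ici_self)
    ⟨(h0.trans_le (min_le_right _ _)).le, hTρ⟩
  have hanti : AntitoneOn (fun τ => V (γ τ)) (Set.Icc 0 T') := by
    refine antitoneOn_of_hasDerivWithinAt_nonpos (convex_Icc 0 T')
      (f' := fun τ => V' (γ τ)) ?_ ?_ ?_
    · exact fun τ hτ => (hderiv γ τ (hγ τ hτ.1)).continuousAt.continuousWithinAt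
    · intro τ hτ
      rw [interior_Icc] at hτ
      exact (hderiv γ τ (hγ τ hτ.1.le)).hasDerivWithinAt
    · intro τ hτ
      rw [interior_Icc] at hτ
      exact hnonpos _ ((hbefore τ hτ.1.le (hτ.2.trans_le hT'T)).trans_le hρr)
  have h1 : V (γ T') ≤ V (γ 0) := hanti ⟨le_rfl, hT'0⟩ ⟨hT'0, le_rfl⟩ hT'0
  have h2 : m ≤ V (γ T') := hmin _ (mem_sphere_iff_norm.2 hT'ρ)
  have h3 : V (γ 0) < m := hdV (by
    rw [dist_eq_norm]
    exact h0.trans_le (min_le_left _ _))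
  linarith

/-- Lyapunov's direct method: a strict Lyapunov function gives local asymptotic stability. -/
theorem LocallyAsympStable.of_orbital_derivative_neg {X : E → E} {V V' : E → ℝ} {p : E} {r : ℝ}
    (hr : 0 < r) (hV : Continuous V) (hV' : Continuous V')
    (hderiv : ∀ (γ : ℝ → E) (t : ℝ), HasDerivAt γ (X (γ t)) t →
      HasDerivAt (fun τ => V (γ τ)) (V' (γ t)) t)
    (hp : V p = 0) (hp' : V' p = 0) (hpos : ∀ q, q ≠ p → 0 < V q)
    (hneg : ∀ q, q ≠ p → ‖q - p‖ < r → V' q < 0) :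
    LocallyAsympStable X Set.univ p := by
  have hstab : LyapunovStable X Set.univ p :=
    .of_orbital_derivative_nonpos hr hV hderiv hp hpos fun q hq => by
      by_cases h : q = p
      · exact (h ▸ hp').le
      · exact (hneg q h hq).le
  refine ⟨hstab, ?_⟩
  obtain ⟨δ, hδ, hδr⟩ := hstab (r / 2) (half_pos hr)
  refine ⟨δ, hδ, fun γ _ hγ h0 => Metric.tendsto_atTop.2 fun ε hε => ?_⟩
  have hin := hδr γ (fun _ _ => Set.mem_univ _) hγ h0
  obtain ⟨d, hd, hdε⟩ := hstab ε hε
  obtain ⟨T, hT, hTd⟩ : ∃ T, 0 ≤ T ∧ ‖γ T - p‖ < d := by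
    by_contra! hcon
    have hK : IsCompact (Metric.closedBall p (r / 2) \ Metric.ball p d) :=
      (isCompact_closedBall p (r / 2)).diff Metric.isOpen_ball
    obtain ⟨m, hm, hmin⟩ := hK.exists_forall_le' (f := fun q => -V' q) hV'.neg.continuousOn
      (a := 0) (fun q hq => by
        refine neg_pos.2 (hneg q ?_ ?_)
        · rintro rfl
          exact hq.2 (Metric.mem_ball_self hd)
        · have := mem_closedBall_iff_norm.1 hq.1
          linarith)
    have hle : ∀ τ, 0 ≤ τ → V' (γ τ) ≤ -m := fun τ hτ => by
      have := hmin (γ τ) ⟨mem_closedBall_iff_norm.2 (hin τ hτ).le,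
        fun h => (hcon τ hτ).not_gt (mem_ball_iff_norm.1 h)⟩
      linarith
    have hanti : AntitoneOn (fun τ => V (γ τ) + m * τ) (Set.Ici 0) := by
      have hd' : ∀ τ, 0 ≤ τ →
          HasDerivAt (fun τ => V (γ τ) + m * τ) (V' (γ τ) + m * 1) τ := fun τ hτ =>
        (hderiv γ τ (hγ τ hτ)).add ((hasDerivAt_id τ).const_mul m)
      refine antitoneOn_of_hasDerivWithinAt_nonpos (convex_Ici 0)
        (f' := fun τ => V' (γ τ) + m * 1) ?_ ?_ ?_
      · exact fun τ hτ => (hd' τ hτ).continuousAt.continuousWithinAt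
      · exact fun τ hτ => (hd' τ (interior_subset hτ)).hasDerivWithinAt
      · intro τ hτ
        have := hle τ (interior_subset hτ)
        linarith
    have hnonneg : ∀ q, 0 ≤ V q := fun q => by
      by_cases h : q = p
      · exact (h ▸ hp).ge
      · exact (hpos q h).le
    have ht : 0 ≤ (V (γ 0) + 1) / m := div_nonneg (by linarith [hnonneg (γ 0)]) hm.le
    have h1 : V (γ ((V (γ 0) + 1) / m)) + m * ((V (γ 0) + 1) / m) ≤ V (γ 0) + m * 0 :=
      hanti Set.self_mem_Ici ht ht
    rw [mul_div_cancel₀ _ hm.ne'] at h1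
    linarith [hnonneg (γ ((V (γ 0) + 1) / m))]
  refine ⟨T, fun t ht => ?_⟩
  have := hdε (fun τ => γ (τ + T)) (fun _ _ => Set.mem_univ _)
    (fun τ hτ => (hγ (τ + T) (by linarith)).comp_add_const τ T) (by simpa using hTd)
    (t - T) (by linarith)
  simpa [dist_eq_norm] using this

end Lyapunov

/-- Half the orbital derivative of `M * (a² + b² + c² + z²) + y²`, with `w = y²` and
`x = z + k * w / 3`, is negative where `L + 3 * x²`, `L + 3 * x² - k * x` and `w` are small. -/
theorem half_orbital_derivative_neg {s k M η a b c z w x L : ℝ} (hs : s ≠ 0)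
    (hk : k ^ 2 = 6 * s ^ 2) (hM : M * s ^ 2 = 3 / 2 * (1 + s ^ 2)) (hη : η = 1 / (10 * M))
    (hL : L = a + 2 * b + 3 * c) (hx : x = z + k * w / 3)
    (hE : |L + 3 * x ^ 2| ≤ η) (hF : |L + 3 * x ^ 2 - k * x| ≤ η) (hw : |w| ≤ η)
    (hne : 0 < a ^ 2 + b ^ 2 + c ^ 2 + z ^ 2 + w ^ 2) :
    M * (2 * a ^ 2 * (L + 3 * x ^ 2 - 1) + 2 * b ^ 2 * (L + 3 * x ^ 2 - 2)
      + 2 * c ^ 2 * (L + 3 * x ^ 2 - 3)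
      + z * (-3 * z + (L + 3 * x ^ 2) * x - 2 * k / 3 * (w * (L + 3 * x ^ 2 - k * x))))
      + w * (L + 3 * x ^ 2 - k * x) < 0 := by
  have hs2 : 0 < s ^ 2 := by positivity
  have hM1 : 3 / 2 < M := by nlinarith
  have hηM : M * η = 1 / 10 := by rw [hη]; field_simp
  have hη0 : 0 < η := by rw [hη]; positivity
  have hη1 : η < 1 / 15 := by nlinarith
  set E := L + 3 * x ^ 2 with hEdef
  set F := E - k * x with hFdef
  have hEle := (abs_le.1 hE).2
  have ha : M * (2 * a ^ 2 * (E - 1)) ≤ M * (2 * a ^ 2 * (-1)) + a ^ 2 / 5 := by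
    nlinarith [mul_le_mul_of_nonneg_left hEle (by positivity : 0 ≤ M * (2 * a ^ 2))]
  have hb : M * (2 * b ^ 2 * (E - 2)) ≤ M * (2 * b ^ 2 * (-2)) + b ^ 2 / 5 := by
    nlinarith [mul_le_mul_of_nonneg_left hEle (by positivity : 0 ≤ M * (2 * b ^ 2))]
  have hc : M * (2 * c ^ 2 * (E - 3)) ≤ M * (2 * c ^ 2 * (-3)) + c ^ 2 / 5 := by
    nlinarith [mul_le_mul_of_nonneg_left hEle (by positivity : 0 ≤ M * (2 * c ^ 2))]
  have hkzw : |k * z * w| ≤ z ^ 2 + 3 / 2 * (s ^ 2 * w ^ 2) := by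
    rw [abs_le]
    constructor
    · nlinarith [sq_nonneg (z + k * w / 2)]
    · nlinarith [sq_nonneg (z - k * w / 2)]
  have hz : z * (E * x - 2 * k / 3 * (w * F)) ≤
      η * (2 * z ^ 2 + 3 / 2 * (s ^ 2 * w ^ 2)) := by
    have h1 : E * z ^ 2 ≤ η * z ^ 2 := mul_le_mul_of_nonneg_right hEle (sq_nonneg z)
    have h2 : |E * (k * z * w)| ≤ η * (z ^ 2 + 3 / 2 * (s ^ 2 * w ^ 2)) := by
      rw [abs_mul]
      exact mul_le_mul hE hkzw (abs_nonneg _) hη0.le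
    have h3 : |F * (k * z * w)| ≤ η * (z ^ 2 + 3 / 2 * (s ^ 2 * w ^ 2)) := by
      rw [abs_mul]
      exact mul_le_mul hF hkzw (abs_nonneg _) hη0.le
    have h4 : z * (E * x - 2 * k / 3 * (w * F)) =
        E * z ^ 2 + E * (k * z * w) / 3 - 2 / 3 * (F * (k * z * w)) := by
      conv_lhs => rw [hx]
      ring
    linarith [(abs_le.1 h2).2, (abs_le.1 h3).1]
  have hx2 : x ^ 2 * w ≤ η * (2 * z ^ 2 + 4 / 3 * (s ^ 2 * w ^ 2)) := by
    have h1 : x ^ 2 ≤ 2 * z ^ 2 + 4 / 3 * (s ^ 2 * w ^ 2) := by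
      have h : 2 * z ^ 2 + 4 / 3 * (s ^ 2 * w ^ 2) - x ^ 2 = (z - k * w / 3) ^ 2 := by
        rw [hx]
        linear_combination (-2 / 9) * w ^ 2 * hk
      linarith [sq_nonneg (z - k * w / 3)]
    calc x ^ 2 * w ≤ x ^ 2 * η := mul_le_mul_of_nonneg_left (abs_le.1 hw).2 (sq_nonneg x)
      _ = η * x ^ 2 := mul_comm _ _
      _ ≤ _ := mul_le_mul_of_nonneg_left h1 hη0.le
  have hy : w * F = w * a + 2 * (w * b) + 3 * (w * c) + 3 * (x ^ 2 * w) - k * z * w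
      - 2 * (s ^ 2 * w ^ 2) := by
    have : k * x * w = k * z * w + 2 * (s ^ 2 * w ^ 2) := by
      rw [hx]
      linear_combination w ^ 2 / 3 * hk
    rw [hFdef, hEdef, hL]
    linear_combination -this
  have hMw : M * (s ^ 2 * w ^ 2) = 3 / 2 * (w ^ 2 + s ^ 2 * w ^ 2) := by
    linear_combination w ^ 2 * hM
  -- Young's inequality with weight `M` for each mixed term
  have young : ∀ u v : ℝ, u * v ≤ M * u ^ 2 + v ^ 2 / (4 * M) := fun u v => by
    have h : M * u ^ 2 + v ^ 2 / (4 * M) - u * v = (2 * M * u - v) ^ 2 / (4 * M) := by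
      field_simp
      ring
    have : 0 ≤ (2 * M * u - v) ^ 2 / (4 * M) := by positivity
    linarith
  have hya := young a w
  have hyb := young b w
  have hyc := young c w
  have hyz := young z (-(k * w))
  have hsum : 6 * (w ^ 2 / (4 * M)) + (-(k * w)) ^ 2 / (4 * M) = s ^ 2 * w ^ 2 := by
    rw [neg_sq, mul_pow, hk]
    field_simp
    linear_combination (-4) * hMw
  have hzM : M * (z * (E * x - 2 * k / 3 * (w * F))) ≤
      1 / 10 * (2 * z ^ 2 + 3 / 2 * (s ^ 2 * w ^ 2)) := by
    rw [← hηM, mul_assoc]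
    exact mul_le_mul_of_nonneg_left hz (by linarith)
  have hx2' : x ^ 2 * w ≤ 1 / 15 * (2 * z ^ 2 + 4 / 3 * (s ^ 2 * w ^ 2)) :=
    hx2.trans (mul_le_mul_of_nonneg_right hη1.le (by positivity))
  have hMa : 3 / 2 * a ^ 2 ≤ M * a ^ 2 := mul_le_mul_of_nonneg_right hM1.le (sq_nonneg a)
  have hMb : 3 / 2 * b ^ 2 ≤ M * b ^ 2 := mul_le_mul_of_nonneg_right hM1.le (sq_nonneg b)
  have hMc : 3 / 2 * c ^ 2 ≤ M * c ^ 2 := mul_le_mul_of_nonneg_right hM1.le (sq_nonneg c)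
  have hMz : 3 / 2 * z ^ 2 ≤ M * z ^ 2 := mul_le_mul_of_nonneg_right hM1.le (sq_nonneg z)
  have hfin : 0 < a ^ 2 + b ^ 2 + c ^ 2 + z ^ 2 + s ^ 2 * w ^ 2 := by
    rcases eq_or_ne w 0 with rfl | h
    · simpa using hne
    · have : 0 < s ^ 2 * w ^ 2 := by positivity
      positivity
  have hw2 : 0 ≤ s ^ 2 * w ^ 2 := by positivity
  linarith [sq_nonneg a, sq_nonneg b, sq_nonneg c, sq_nonneg z]

theorem stmt_12 (s : ℝ) (hs : s ≠ 0) :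
    X12 s 0 = 0 ∧
      LocallyAsympStable (X12 s) (Set.univ : Set (Fin 5 → ℝ)) 0 := by
  refine ⟨by ext i; fin_cases i <;> simp [X12], ?_⟩
  obtain ⟨k, hkdef⟩ : ∃ k, k = Real.sqrt 6 * s := ⟨_, rfl⟩
  have hk : k ^ 2 = 6 * s ^ 2 := by rw [hkdef, mul_pow, Real.sq_sqrt (by norm_num)]
  obtain ⟨M, hM0, hM⟩ : ∃ M > 0, M * s ^ 2 = 3 / 2 * (1 + s ^ 2) :=
    ⟨3 / 2 * (1 + s ^ 2) / s ^ 2, by positivity, by field_simp⟩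
  have hη : 0 < 1 / (10 * M) := by positivity
  have hsmall : ∀ g : (Fin 5 → ℝ) → ℝ, Continuous g → g 0 = 0 →
      ∀ᶠ p in nhds 0, |g p| ≤ 1 / (10 * M) := fun g hg h0 =>
    (hg.abs.tendsto 0).eventually_le_const (by simpa [h0] using hη)
  obtain ⟨r, hr, hball⟩ := Metric.eventually_nhds_iff.1
    ((hsmall (fun p => p 0 + 2 * p 1 + 3 * p 2 + 3 * p 3 ^ 2) (by fun_prop) (by simp)).and
      ((hsmall (fun p => p 0 + 2 * p 1 + 3 * p 2 + 3 * p 3 ^ 2 - k * p 3) (by fun_prop)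
        (by simp)).and (hsmall (fun p => p 4 ^ 2) (by fun_prop) (by simp))))
  have hvanish : ∀ q : Fin 5 → ℝ, q ≠ 0 →
      0 < q 0 ^ 2 + q 1 ^ 2 + q 2 ^ 2 + (q 3 - k / 3 * q 4 ^ 2) ^ 2 + (q 4 ^ 2) ^ 2 := by
    intro q hq
    by_contra! h
    have h4 : (q 4 ^ 2) ^ 2 = 0 := by
      linarith [sq_nonneg (q 0), sq_nonneg (q 1), sq_nonneg (q 2),
        sq_nonneg (q 3 - k / 3 * q 4 ^ 2), sq_nonneg (q 4 ^ 2)]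
    have h4' : q 4 = 0 := by simpa using h4
    simp only [h4', ne_eq, OfNat.ofNat_ne_zero, not_false_eq_true, zero_pow, mul_zero, sub_zero,
      add_zero] at h
    have hsq : q 0 ^ 2 = 0 ∧ q 1 ^ 2 = 0 ∧ q 2 ^ 2 = 0 ∧ q 3 ^ 2 = 0 := by
      refine ⟨?_, ?_, ?_, ?_⟩ <;>
        linarith [sq_nonneg (q 0), sq_nonneg (q 1), sq_nonneg (q 2), sq_nonneg (q 3)]
    simp only [pow_eq_zero_iff two_ne_zero] at hsq
    apply hq
    ext i
    fin_cases i <;> simp [hsq, h4']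
  refine LocallyAsympStable.of_orbital_derivative_neg hr
    (V := fun q => M * (q 0 ^ 2 + q 1 ^ 2 + q 2 ^ 2 + (q 3 - k / 3 * q 4 ^ 2) ^ 2) + q 4 ^ 2)
    (V' := fun q => 2 * (M * (q 0 * X12 s q 0 + q 1 * X12 s q 1 + q 2 * X12 s q 2
      + (q 3 - k / 3 * q 4 ^ 2) * (X12 s q 3 - k / 3 * (2 * q 4 * X12 s q 4)))
      + q 4 * X12 s q 4))
    (by fun_prop) (by simp only [X12, Matrix.cons_val]; fun_prop) ?_ (by simp) (by simp) ?_ ?_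
  · intro γ t h
    have hc := hasDerivAt_pi.1 h
    have h4 := (hc 4).pow 2
    refine ((((((hc 0).pow 2).add ((hc 1).pow 2)).add ((hc 2).pow 2)).add
      (((hc 3).sub (h4.const_mul (k / 3))).pow 2)).const_mul M |>.add h4).congr_deriv ?_
    simp only [Pi.sub_apply, Pi.pow_apply]
    push_cast
    ring
  · intro q hq
    have h := hvanish q hq
    rcases eq_or_ne (q 4) 0 with h4 | h4
    · have h' : 0 < q 0 ^ 2 + q 1 ^ 2 + q 2 ^ 2 + (q 3 - k / 3 * q 4 ^ 2) ^ 2 := by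
        simpa [h4] using h
      positivity
    · positivity
  · intro q hq hqr
    obtain ⟨hE, hF, hw⟩ := hball (by simpa using hqr)
    have h := half_orbital_derivative_neg hs hk hM rfl rfl
      (show q 3 = (q 3 - k / 3 * q 4 ^ 2) + k * q 4 ^ 2 / 3 by ring) hE hF hw (hvanish q hq)
    simp only [X12, Matrix.cons_val, ← hkdef]
    linear_combination 2 * h
end
end

section
/- Let s : ℝ → ℝ be continuous and let x : ℝ → ℝ be differentiable with x'(N) = (3·x(N) − √6·s(N))·(x(N)² − 1) for all N ∈ ℝ. If |x(0)| < 1 then |x(N)| < 1 for all N ∈ ℝ; and if |x(0)| ≤ 1 then |x(N)| ≤ 1 for all N ∈ ℝ. -/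
open Real

/-- Solutions of a scalar linear homogeneous equation with continuous coefficient. -/
theorem eq_mul_exp_integral_of_hasDerivAt {a y : ℝ → ℝ} (ha : Continuous a)
    (hy : ∀ t, HasDerivAt y (a t * y t) t) (t : ℝ) :
    y t = y 0 * exp (∫ u in (0 : ℝ)..t, a u) := by
  have hA (t : ℝ) : HasDerivAt (fun r => ∫ u in (0 : ℝ)..r, a u) (a t) t :=
    ha.integral_hasStrictDerivAt 0 t |>.hasDerivAt
  have hz (t : ℝ) : HasDerivAt (fun r => y r * exp (-∫ u in (0 : ℝ)..r, a u)) 0 t := by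
    refine ((hy t).mul (hA t).neg.exp).congr_deriv ?_
    simp only [Pi.neg_apply]
    ring
  have h := is_const_of_deriv_eq_zero (fun t => (hz t).differentiableAt)
    (fun t => (hz t).deriv) t 0
  simp only [intervalIntegral.integral_same, neg_zero, exp_zero, mul_one] at h
  rw [← h, mul_assoc, ← exp_add, neg_add_cancel, exp_zero, mul_one]

theorem stmt_13 (s : ℝ → ℝ) (hs : Continuous s) (x : ℝ → ℝ)
    (hx : ∀ N : ℝ, HasDerivAt x ((3 * x N - Real.sqrt 6 * s N) * (x N ^ 2 - 1)) N) :
    (|x 0| < 1 → ∀ N : ℝ, |x N| < 1) ∧ (|x 0| ≤ 1 → ∀ N : ℝ, |x N| ≤ 1) := by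
  have hxc : Continuous x := continuous_iff_continuousAt.2 fun N => (hx N).continuousAt
  have ha : Continuous fun N => 2 * x N * (3 * x N - √6 * s N) := by fun_prop
  have hy (N : ℝ) : HasDerivAt (fun r => x r ^ 2 - 1)
      (2 * x N * (3 * x N - √6 * s N) * (x N ^ 2 - 1)) N := by
    refine (((hx N).pow 2).sub_const 1).congr_deriv ?_
    simp only [Nat.cast_ofNat, Nat.add_one_sub_one, pow_one]
    ring
  have key := eq_mul_exp_integral_of_hasDerivAt ha hy
  refine ⟨fun h N => ?_, fun h N => ?_⟩
  · rw [← sq_lt_one_iff_abs_lt_one] at h ⊢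
    exact sub_neg.1 ((key N).trans_lt (mul_neg_of_neg_of_pos (sub_neg.2 h) (exp_pos _)))
  · rw [← sq_le_one_iff_abs_le_one] at h ⊢
    exact sub_nonpos.1
      ((key N).trans_le (mul_nonpos_of_nonpos_of_nonneg (sub_nonpos.2 h) (exp_pos _).le))
end

section
/- Let s ∈ ℝ with s² < 1. Consider the planar vector field X(x,Z) = ( (x²−1)(3x − √6·s), (2−3x²)·Z·(Z²−1) ) on ℝ². Then the point (√(2/3)·s, 0) is an equilibrium of X and it is locally asymptotically stable: it is Lyapunov stable, and there exists δ > 0 such that every differentiable curve γ : [0,∞) → ℝ² with γ'(t) = X(γ(t)) for all t and ‖γ(0) − (√(2/3)·s, 0)‖ < δ satisfies γ(t) → (√(2/3)·s, 0) as t → ∞. -/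
open Real Filter

noncomputable section

/-- The compactified planar HL vector field, flat universe, Λ = 0, detailed balance,
exponential potential; coordinates `(x, Z)`. -/
def Xexp (s : ℝ) (p : ℝ × ℝ) : ℝ × ℝ :=
  ((p.1 ^ 2 - 1) * (3 * p.1 - Real.sqrt 6 * s),
   (2 - 3 * p.1 ^ 2) * p.2 * (p.2 ^ 2 - 1))

/-- A nonnegative level `M` below `R` bounds `f` by a decaying exponential as soon as `f` starts
below `M` and satisfies `f' ≤ -2 c f` wherever `0 < f < R`. -/
theorem le_mul_exp_of_deriv_le {f f' : ℝ → ℝ} {c M R : ℝ} (hc : 0 < c) (hM : 0 < M) (hMR : M < R)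
    (hf : ∀ t, 0 ≤ t → HasDerivAt f (f' t) t) (h0 : f 0 ≤ M)
    (hf' : ∀ t, 0 ≤ t → f t < R → f' t ≤ -(2 * c) * f t) {t : ℝ} (ht : 0 ≤ t) :
    f t ≤ M * exp (-c * t) := by
  have hB : ∀ x, HasDerivAt (fun u => M * exp (-c * u)) (M * (exp (-c * x) * (-c))) x := by
    intro x
    simpa using (((hasDerivAt_id x).const_mul (-c)).exp).const_mul M
  refine image_le_of_deriv_right_lt_deriv_boundary (a := 0) (b := t) (f' := f')
    (fun x hx => (hf x hx.1).continuousAt.continuousWithinAt)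
    (fun x hx => (hf x hx.1).hasDerivWithinAt) (by simpa using h0) hB ?_ ⟨ht, le_rfl⟩
  intro x hx hfx
  have hpos : 0 < M * exp (-c * x) := by positivity
  have hle : M * exp (-c * x) ≤ M :=
    mul_le_of_le_one_right hM.le (exp_le_one_iff.2 (by nlinarith [hx.1]))
  have := hf' x hx.1 (by linarith)
  rw [hfx] at this
  nlinarith [mul_pos hc hpos]

theorem norm_sq_le_fst_sq_add_snd_sq (v : ℝ × ℝ) : ‖v‖ ^ 2 ≤ v.1 ^ 2 + v.2 ^ 2 := by
  rw [Prod.norm_def, Real.norm_eq_abs, Real.norm_eq_abs]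
  rcases max_choice |v.1| |v.2| with h | h <;> rw [h, sq_abs] <;>
    nlinarith [sq_nonneg v.1, sq_nonneg v.2]

theorem fst_sq_add_snd_sq_le (v : ℝ × ℝ) : v.1 ^ 2 + v.2 ^ 2 ≤ 2 * ‖v‖ ^ 2 := by
  have h1 := pow_le_pow_left₀ (norm_nonneg _) (norm_fst_le v) 2
  have h2 := pow_le_pow_left₀ (norm_nonneg _) (norm_snd_le v) 2
  simp only [Real.norm_eq_abs, sq_abs] at h1 h2
  linarith

theorem sqrt_six_mul_eq (s : ℝ) : √6 * s = 3 * (√(2 / 3) * s) := by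
  have h : (6 : ℝ) = 3 ^ 2 * (2 / 3) := by norm_num
  rw [h, Real.sqrt_mul (by positivity), Real.sqrt_sq (by norm_num), mul_assoc]

/-- Near its attractor, the field `Xexp s` points inward at a linear rate. -/
theorem exists_Xexp_rate {s : ℝ} (hs : s ^ 2 < 1) :
    ∃ k > 0, ∃ ρ > 0, ∀ v : ℝ × ℝ, ‖v - (√(2 / 3) * s, 0)‖ < ρ →
      k ≤ 1 - v.1 ^ 2 ∧ k ≤ (2 - 3 * v.1 ^ 2) * (1 - v.2 ^ 2) := by
  have ha : (√(2 / 3) * s) ^ 2 = 2 / 3 * s ^ 2 := by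
    rw [mul_pow, Real.sq_sqrt (by norm_num)]
  have hcont1 : Continuous fun v : ℝ × ℝ => 1 - v.1 ^ 2 := by fun_prop
  have hcont2 : Continuous fun v : ℝ × ℝ => (2 - 3 * v.1 ^ 2) * (1 - v.2 ^ 2) := by fun_prop
  have h1 := (hcont1.tendsto (√(2 / 3) * s, 0)).eventually_const_lt
    (u := (1 - s ^ 2) / 3) (by simp only [ha]; linarith)
  have h2 := (hcont2.tendsto (√(2 / 3) * s, 0)).eventually_const_lt
    (u := (1 - s ^ 2) / 3) (by simp only [ha]; linarith)
  obtain ⟨ρ, hρ, h⟩ := Metric.eventually_nhds_iff.1 (h1.and h2)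
  refine ⟨(1 - s ^ 2) / 3, by linarith, ρ, hρ, fun v hv => ?_⟩
  have := h (by rwa [dist_eq_norm])
  exact ⟨this.1.le, this.2.le⟩

/-- Solutions of `Xexp s` that start near the attractor approach it exponentially. -/
theorem exists_norm_sq_le_mul_exp {s : ℝ} (hs : s ^ 2 < 1) :
    ∃ c > 0, ∃ ρ > 0, ∀ m, 0 < m → m ≤ ρ → ∀ γ : ℝ → ℝ × ℝ,
      (∀ t, 0 ≤ t → HasDerivAt γ (Xexp s (γ t)) t) →
      ‖γ 0 - (√(2 / 3) * s, 0)‖ < m / 2 → ∀ t, 0 ≤ t →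
        ‖γ t - (√(2 / 3) * s, 0)‖ ^ 2 ≤ m ^ 2 / 2 * exp (-c * t) := by
  obtain ⟨k, hk, ρ, hρ, hrate⟩ := exists_Xexp_rate hs
  refine ⟨k, hk, ρ, hρ, fun m hm hmρ γ hγ h0 t ht => ?_⟩
  refine (norm_sq_le_fst_sq_add_snd_sq _).trans ?_
  simp only [Prod.fst_sub, Prod.snd_sub, sub_zero]
  set a := √(2 / 3) * s with ha
  refine le_mul_exp_of_deriv_le (f := fun u => ((γ u).1 - a) ^ 2 + (γ u).2 ^ 2)
    (f' := fun u => 2 * ((γ u).1 - a) * (Xexp s (γ u)).1 + 2 * (γ u).2 * (Xexp s (γ u)).2)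
    (R := ρ ^ 2) hk (by positivity) (by nlinarith) ?_ ?_ ?_ ht
  · intro u hu
    have hx := ((hasFDerivAt_fst (𝕜 := ℝ) (p := γ u)).comp_hasDerivAt u (hγ u hu)).sub_const a
    have hz := (hasFDerivAt_snd (𝕜 := ℝ) (p := γ u)).comp_hasDerivAt u (hγ u hu)
    refine ((hx.pow 2).add (hz.pow 2)).congr_deriv ?_
    simp
  · have h := fst_sq_add_snd_sq_le (γ 0 - (a, 0))
    simp only [Prod.fst_sub, Prod.snd_sub, sub_zero] at h
    nlinarith [norm_nonneg (γ 0 - (a, 0))]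
  · intro u hu hlt
    have hnear : ‖γ u - (a, 0)‖ < ρ := by
      refine lt_of_pow_lt_pow_left₀ 2 hρ.le ((norm_sq_le_fst_sq_add_snd_sq _).trans_lt ?_)
      simpa using hlt
    obtain ⟨h1, h2⟩ := hrate _ hnear
    simp only [Xexp, sqrt_six_mul_eq, ← ha]
    nlinarith [mul_le_mul_of_nonneg_right h1 (sq_nonneg ((γ u).1 - a)),
      mul_le_mul_of_nonneg_right h2 (sq_nonneg (γ u).2),
      mul_nonneg hk.le (sq_nonneg ((γ u).1 - a))]

theorem stmt_14 (s : ℝ) (hs : s ^ 2 < 1) :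
    Xexp s (Real.sqrt (2 / 3) * s, 0) = (0, 0) ∧
      LocallyAsympStable (Xexp s) (Set.univ : Set (ℝ × ℝ)) (Real.sqrt (2 / 3) * s, 0) := by
  refine ⟨by simp [Xexp, sqrt_six_mul_eq], ?_⟩
  obtain ⟨c, hc, ρ, hρ, hdecay⟩ := exists_norm_sq_le_mul_exp hs
  refine ⟨fun ε hε => ?_, ρ / 2, by positivity, fun γ _ hγ h0 => ?_⟩
  · have hm : 0 < min ρ ε := lt_min hρ hε
    refine ⟨min ρ ε / 2, by positivity, fun γ _ hγ h0 t ht => ?_⟩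
    have h := hdecay _ hm (min_le_left _ _) γ hγ h0 t ht
    have hexp : exp (-c * t) ≤ 1 := exp_le_one_iff.2 (by nlinarith)
    refine (lt_of_pow_lt_pow_left₀ 2 hm.le ?_).trans_le (min_le_right ρ ε)
    nlinarith [pow_pos hm 2]
  · rw [tendsto_iff_norm_sub_tendsto_zero]
    have hlim : Tendsto (fun t => ρ ^ 2 / 2 * exp (-c * t)) atTop (nhds 0) := by
      have := (tendsto_exp_atBot.comp
        (tendsto_id.const_mul_atTop_of_neg (neg_lt_zero.2 hc))).const_mul (ρ ^ 2 / 2)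
      simpa using this
    have hsq : Tendsto (fun t => ‖γ t - (√(2 / 3) * s, 0)‖ ^ 2) atTop (nhds 0) :=
      squeeze_zero' (Eventually.of_forall fun t => by positivity)
        ((eventually_ge_atTop 0).mono fun t ht => hdecay ρ hρ le_rfl γ hγ h0 t ht) hlim
    simpa using hsq.sqrt
end
end

section
/- Let s ∈ ℝ with s < √(3/2). Consider the planar vector field X(x,Z) = ( (x²−1)(3x − √6·s), (2−3x²)·Z·(Z²−1) ) on ℝ². Then the point (1, 0) is an equilibrium of X and it is a source: it is a locally asymptotically stable equilibrium of the time-reversed vector field −X, i.e. −X is Lyapunov stable at (1,0) and there exists δ > 0 such that every differentiable curve γ : [0,∞) → ℝ² with γ'(t) = −X(γ(t)) for all t and ‖γ(0) − (1,0)‖ < δ satisfies γ(t) → (1,0) as t → ∞. -/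
open Real Filter

noncomputable section

/-- A differentiable function which satisfies `f' ≤ -2 * k * f` wherever `0 < f < ρ`, and starts at
most at `A < ρ`, decays exponentially. -/
theorem le_mul_exp_neg_of_deriv_le {f f' : ℝ → ℝ} {A ρ k : ℝ} (hA : 0 < A) (hAρ : A < ρ)
    (hk : 0 < k) (hf : ∀ t, 0 ≤ t → HasDerivAt f (f' t) t) (h0 : f 0 ≤ A)
    (hdecay : ∀ t, 0 ≤ t → 0 < f t → f t < ρ → f' t ≤ -(2 * k) * f t) {t : ℝ} (ht : 0 ≤ t) :
    f t ≤ A * exp (-k * t) := by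
  have hB : ∀ x, HasDerivAt (fun y => A * exp (-k * y)) (-k * (A * exp (-k * x))) x := by
    intro x
    have h := (((hasDerivAt_id' x).const_mul (-k)).exp).const_mul A
    exact h.congr_deriv (by ring)
  refine image_le_of_deriv_right_lt_deriv_boundary
    (fun x hx => (hf x hx.1).continuousAt.continuousWithinAt)
    (fun x hx => (hf x hx.1).hasDerivWithinAt) (by simpa using h0) hB ?_
    (Set.right_mem_Icc.2 ht)
  intro x hx hfx
  have hpos : 0 < A * exp (-k * x) := by positivity
  have hle : A * exp (-k * x) ≤ A :=
    mul_le_of_le_one_right hA.le (exp_le_one_iff.2 (by nlinarith [hx.1]))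
  have hd := hdecay x hx.1 (hfx ▸ hpos) (hfx ▸ hle.trans_lt hAρ)
  rw [hfx] at hd
  nlinarith

theorem sqrt_six_mul_lt_three {s : ℝ} (hs : s < √(3 / 2)) : √6 * s < 3 := by
  have h : √6 * √(3 / 2) = 3 := by
    rw [← Real.sqrt_mul (by norm_num), show (6 : ℝ) * (3 / 2) = 3 ^ 2 by norm_num]
    exact Real.sqrt_sq (by norm_num)
  calc √6 * s < √6 * √(3 / 2) := mul_lt_mul_of_pos_left hs (by positivity)
    _ = 3 := h

/-- Near `(1, 0)` the squared Euclidean distance to `(1, 0)` is a strict Lyapunov function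
for `-Xexp s`. -/
theorem exists_lyapunov_estimate {s : ℝ} (hs : s < √(3 / 2)) :
    ∃ r > 0, ∃ k > 0, ∀ x z : ℝ, (x - 1) ^ 2 + z ^ 2 < r ^ 2 →
      2 * (x - 1) * (-Xexp s (x, z)).1 + 2 * z * (-Xexp s (x, z)).2
        ≤ -(2 * k) * ((x - 1) ^ 2 + z ^ 2) := by
  obtain ⟨c, hc⟩ : ∃ c, c = 3 - √6 * s := ⟨_, rfl⟩
  have hc0 : 0 < c := by linarith [sqrt_six_mul_lt_three hs]
  refine ⟨min (c / 6) (1 / 10), by positivity, min (c / 2) (2 / 5), by positivity, ?_⟩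
  intro x z h
  have hr : 0 < min (c / 6) (1 / 10) := by positivity
  have hx := abs_lt_of_sq_lt_sq (a := x - 1) (by nlinarith [sq_nonneg z]) hr.le
  have hz := abs_lt_of_sq_lt_sq (a := z) (by nlinarith [sq_nonneg (x - 1)]) hr.le
  have hr1 := min_le_left (c / 6) (1 / 10)
  have hr2 := min_le_right (c / 6) (1 / 10)
  rw [abs_lt] at hx hz
  have hk1 := min_le_left (c / 2) (2 / 5)
  have hk2 := min_le_right (c / 2) (2 / 5)
  have hP : min (c / 2) (2 / 5) ≤ (x + 1) * (3 * (x - 1) + c) := by nlinarith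
  have hQ : min (c / 2) (2 / 5) ≤ (3 * x ^ 2 - 2) * (1 - z ^ 2) := by
    have hx2 : 2 / 5 + 3 / 100 ≤ 3 * x ^ 2 - 2 := by nlinarith
    have hz2 : 99 / 100 ≤ 1 - z ^ 2 := by nlinarith
    nlinarith
  have h1 := mul_le_mul_of_nonneg_left hP (sq_nonneg (x - 1))
  have h2 := mul_le_mul_of_nonneg_left hQ (sq_nonneg z)
  have hs' : √6 * s = 3 - c := by linarith
  simp only [Xexp, Prod.fst_neg, Prod.snd_neg, hs']
  linear_combination 2 * h1 + 2 * h2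

/-- Solutions of `γ' = -Xexp s γ` starting near `(1, 0)` converge to it exponentially. -/
theorem exists_exp_decay {s : ℝ} (hs : s < √(3 / 2)) :
    ∃ r > 0, ∃ k > 0, ∀ η, 0 < η → η ≤ r → ∀ γ : ℝ → ℝ × ℝ,
      (∀ t : ℝ, 0 ≤ t → HasDerivAt γ (-Xexp s (γ t)) t) → ‖γ 0 - (1, 0)‖ < η / 2 →
      ∀ t : ℝ, 0 ≤ t → ((γ t).1 - 1) ^ 2 + (γ t).2 ^ 2 ≤ η ^ 2 / 2 * exp (-k * t) := by
  obtain ⟨r, hr, k, hk, hV⟩ := exists_lyapunov_estimate hs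
  refine ⟨r, hr, k, hk, fun η hη hηr γ hγ h0 t ht => ?_⟩
  refine le_mul_exp_neg_of_deriv_le
    (f := fun t => ((γ t).1 - 1) ^ 2 + (γ t).2 ^ 2) (ρ := r ^ 2)
    (f' := fun t => 2 * ((γ t).1 - 1) * (-Xexp s (γ t)).1 + 2 * (γ t).2 * (-Xexp s (γ t)).2)
    (by positivity) (by nlinarith) hk ?_ ?_ ?_ ht
  · intro u hu
    have h1 : HasDerivAt (fun v => (γ v).1) (-Xexp s (γ u)).1 u :=
      (ContinuousLinearMap.fst ℝ ℝ ℝ).hasFDerivAt.comp_hasDerivAt u (hγ u hu)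
    have h2 : HasDerivAt (fun v => (γ v).2) (-Xexp s (γ u)).2 u :=
      (ContinuousLinearMap.snd ℝ ℝ ℝ).hasFDerivAt.comp_hasDerivAt u (hγ u hu)
    simpa using ((h1.sub_const 1).fun_pow 2).fun_add (h2.fun_pow 2)
  · rw [Prod.norm_def, max_lt_iff] at h0
    simp only [Prod.fst_sub, Prod.snd_sub, sub_zero, Real.norm_eq_abs, abs_lt] at h0
    nlinarith [h0.1.1, h0.1.2, h0.2.1, h0.2.2]
  · intro u _ _ hu
    exact hV _ _ hu

theorem norm_sub_lt_of_sq_add_sq_lt {p : ℝ × ℝ} {ε : ℝ} (hε : 0 < ε)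
    (h : (p.1 - 1) ^ 2 + p.2 ^ 2 < ε ^ 2) : ‖p - (1, 0)‖ < ε := by
  rw [Prod.norm_def, max_lt_iff]
  simp only [Prod.fst_sub, Prod.snd_sub, sub_zero, Real.norm_eq_abs]
  exact ⟨abs_lt_of_sq_lt_sq (by nlinarith [sq_nonneg p.2]) hε.le,
    abs_lt_of_sq_lt_sq (by nlinarith [sq_nonneg (p.1 - 1)]) hε.le⟩

theorem stmt_15 (s : ℝ) (hs : s < Real.sqrt (3 / 2)) :
    Xexp s (1, 0) = (0, 0) ∧
      LocallyAsympStable (fun p => -Xexp s p) (Set.univ : Set (ℝ × ℝ)) (1, 0) := by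
  obtain ⟨r, hr, k, hk, hdecay⟩ := exists_exp_decay hs
  refine ⟨by simp [Xexp], ?_, ?_⟩
  · intro ε hε
    have hη : 0 < min ε r := lt_min hε hr
    refine ⟨min ε r / 2, by positivity, fun γ _ hγ h0 t ht => ?_⟩
    refine (norm_sub_lt_of_sq_add_sq_lt hη ?_).trans_le (min_le_left ε r)
    have hexp : exp (-k * t) ≤ 1 := exp_le_one_iff.2 (by nlinarith)
    have := hdecay _ hη (min_le_right ε r) γ hγ h0 t ht
    nlinarith [pow_pos hη 2]
  · refine ⟨r / 2, by positivity, fun γ _ hγ h0 => ?_⟩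
    have hlim : Tendsto (fun t => r ^ 2 / 2 * exp (-k * t)) atTop (nhds 0) := by
      have h : Tendsto (fun t => -k * t) atTop atBot :=
        tendsto_id.const_mul_atTop_of_neg (by linarith)
      simpa using (tendsto_exp_atBot.comp h).const_mul (r ^ 2 / 2)
    rw [Metric.tendsto_nhds]
    intro ε hε
    filter_upwards [hlim.eventually_lt_const (pow_pos hε 2), eventually_ge_atTop 0]
      with t hlt ht
    rw [dist_eq_norm]
    exact norm_sub_lt_of_sq_add_sq_lt hε ((hdecay r hr le_rfl γ hγ h0 t ht).trans_lt hlt)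
end
end

section
/- Let s ∈ ℝ with 1 < s² < 3/2. Consider the planar vector field X(x,Z) = ( (x²−1)(3x − √6·s), (2−3x²)·Z·(Z²−1) ) on ℝ². Then the point (√(2/3)·s, 1) is an equilibrium of X and it is locally asymptotically stable: it is Lyapunov stable, and there exists δ > 0 such that every differentiable curve γ : [0,∞) → ℝ² with γ'(t) = X(γ(t)) for all t and ‖γ(0) − (√(2/3)·s, 1)‖ < δ satisfies γ(t) → (√(2/3)·s, 1) as t → ∞. -/
open Real Filter

noncomputable section

/-- A solution of `y' = -g y` decays exponentially if `g` is bounded below by a positive constant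
as long as `y` stays in a ball containing its initial value. -/
theorem abs_le_mul_exp_of_hasDerivAt_neg_mul {y g : ℝ → ℝ} {c r ρ : ℝ} (hc : 0 < c) (hρ : 0 < ρ)
    (hρr : ρ < r) (hy : ∀ t : ℝ, 0 ≤ t → HasDerivAt y (-(g t * y t)) t)
    (hg : ∀ t : ℝ, 0 ≤ t → |y t| < r → c ≤ g t) (h0 : |y 0| ≤ ρ) {t : ℝ} (ht : 0 ≤ t) :
    |y t| ≤ ρ * exp (-(c / 2) * t) := by
  have hB : ∀ x : ℝ, HasDerivAt (fun x => (ρ * exp (-(c / 2) * x)) ^ 2)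
      (-c * (ρ * exp (-(c / 2) * x)) ^ 2) x := fun x => by
    have := ((((hasDerivAt_id x).const_mul (-(c / 2))).exp.const_mul ρ).pow 2)
    refine this.congr_deriv ?_
    simp only [id]
    push_cast
    ring
  have hf : ∀ x : ℝ, 0 ≤ x → HasDerivAt (fun x => y x ^ 2) (-2 * g x * y x ^ 2) x :=
    fun x hx => ((hy x hx).pow 2).congr_deriv (by push_cast; ring)
  have key : ∀ ⦃x⦄, x ∈ Set.Icc 0 t → y x ^ 2 ≤ (ρ * exp (-(c / 2) * x)) ^ 2 := by
    refine image_le_of_deriv_right_lt_deriv_boundary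
      (fun x hx => (hf x hx.1).continuousAt.continuousWithinAt)
      (fun x hx => (hf x hx.1).hasDerivWithinAt) ?_ hB ?_
    · simpa using sq_le_sq' (by linarith [neg_abs_le (y 0)]) ((le_abs_self _).trans h0)
    · intro x hx hxB
      have hpos : 0 < ρ * exp (-(c / 2) * x) := by positivity
      have hexp : exp (-(c / 2) * x) ≤ 1 := exp_le_one_iff.2 (by nlinarith [hx.1])
      have habs : |y x| < r := by
        have := abs_le_of_sq_le_sq hxB.le hpos.le
        nlinarith
      have hgx := hg x hx.1 habs
      rw [← hxB]
      have : 0 < y x ^ 2 := by rw [hxB]; positivity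
      nlinarith
  exact abs_le_of_sq_le_sq' (key ⟨ht, le_rfl⟩) (by positivity) |> abs_le.2

/-- A uniform exponential bound on trajectories starting near `p` gives local asymptotic
stability of `p`. -/
theorem locallyAsympStable_of_exp_bound {E : Type*} [NormedAddCommGroup E] [NormedSpace ℝ E]
    {X : E → E} {D : Set E} {p : E} {c r : ℝ} (hc : 0 < c) (hr : 0 < r)
    (h : ∀ ρ, 0 < ρ → ρ < r → ∀ γ : ℝ → E, (∀ t : ℝ, 0 ≤ t → γ t ∈ D) →
      (∀ t : ℝ, 0 ≤ t → HasDerivAt γ (X (γ t)) t) → ‖γ 0 - p‖ < ρ →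
      ∀ t : ℝ, 0 ≤ t → ‖γ t - p‖ ≤ ρ * exp (-c * t)) :
    LocallyAsympStable X D p := by
  refine ⟨fun ε hε => ⟨min (ε / 2) (r / 2), by positivity, fun γ hD hγ h0 t ht => ?_⟩,
    r / 2, by positivity, fun γ hD hγ h0 => ?_⟩
  · have hb := h _ (by positivity) ((min_le_right _ _).trans_lt (half_lt_self hr)) γ hD hγ h0 t ht
    have hexp : exp (-c * t) ≤ 1 := exp_le_one_iff.2 (by nlinarith)
    calc ‖γ t - p‖ ≤ min (ε / 2) (r / 2) * exp (-c * t) := hb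
      _ ≤ min (ε / 2) (r / 2) := mul_le_of_le_one_right (by positivity) hexp
      _ ≤ ε / 2 := min_le_left _ _
      _ < ε := half_lt_self hε
  · rw [tendsto_iff_norm_sub_tendsto_zero]
    refine squeeze_zero' (Eventually.of_forall fun t => norm_nonneg _)
      ((eventually_ge_atTop 0).mono
        (h (r / 2) (by positivity) (half_lt_self hr) γ hD hγ h0)) ?_
    have : Tendsto (fun t : ℝ => -c * t) atTop atBot :=
      tendsto_id.const_mul_atTop_of_neg (neg_lt_zero.2 hc)
    simpa using (tendsto_exp_atBot.comp this).const_mul (r / 2)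

theorem stmt_16 (s : ℝ) (hs1 : 1 < s ^ 2) (hs2 : s ^ 2 < 3 / 2) :
    Xexp s (Real.sqrt (2 / 3) * s, 1) = (0, 0) ∧
      LocallyAsympStable (Xexp s) (Set.univ : Set (ℝ × ℝ)) (Real.sqrt (2 / 3) * s, 1) := by
  have h6 : √6 * s = 3 * (√(2 / 3) * s) := by
    rw [show (6 : ℝ) = 3 ^ 2 * (2 / 3) by norm_num, Real.sqrt_mul (by norm_num),
      Real.sqrt_sq (by norm_num)]
    ring
  have ha : (√(2 / 3) * s) ^ 2 = 2 / 3 * s ^ 2 := by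
    rw [mul_pow, Real.sq_sqrt (by norm_num)]
  unfold Xexp
  rw [h6]
  generalize √(2 / 3) * s = a at ha ⊢
  refine ⟨by simp, ?_⟩
  obtain ⟨k, hk, hk1, hk2⟩ : ∃ k > 0, k < 3 * a ^ 2 - 2 ∧ k < 3 * (1 - a ^ 2) := by
    obtain ⟨k, hk, hk'⟩ := exists_between
      (show 0 < min (3 * a ^ 2 - 2) (3 * (1 - a ^ 2)) from lt_min (by linarith) (by linarith))
    exact ⟨k, hk, lt_min_iff.1 hk'⟩
  obtain ⟨r₀, hr₀, hball⟩ : ∃ r > 0, ∀ x, |x - a| < r →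
      k < 3 * x ^ 2 - 2 ∧ k < 3 * (1 - x ^ 2) := by
    have h1 : ∀ᶠ x in nhds a, k < 3 * x ^ 2 - 2 :=
      (show ContinuousAt (fun x : ℝ => 3 * x ^ 2 - 2) a by fun_prop).eventually_const_lt hk1
    have h2 : ∀ᶠ x in nhds a, k < 3 * (1 - x ^ 2) :=
      (show ContinuousAt (fun x : ℝ => 3 * (1 - x ^ 2)) a by fun_prop).eventually_const_lt hk2
    obtain ⟨r, hr, h⟩ := Metric.eventually_nhds_iff.1 (h1.and h2)
    exact ⟨r, hr, fun x hx => h (by rwa [Real.dist_eq])⟩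
  refine locallyAsympStable_of_exp_bound (c := k / 2 / 2) (r := min r₀ (1 / 2))
    (by positivity) (by positivity) fun ρ hρ hρr γ _ hγ h0 => ?_
  have hρ₀ : ρ < r₀ := hρr.trans_le (min_le_left _ _)
  rw [Prod.norm_def, max_lt_iff] at h0
  have hx : ∀ t : ℝ, 0 ≤ t → |(γ t).1 - a| ≤ ρ * exp (-(k / 2 / 2) * t) := fun t ht =>
    abs_le_mul_exp_of_hasDerivAt_neg_mul (y := fun t => (γ t).1 - a)
      (g := fun t => 3 * (1 - (γ t).1 ^ 2)) (by positivity) hρ hρ₀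
      (fun t ht => (((hasFDerivAt_fst (𝕜 := ℝ)).comp_hasDerivAt t (hγ t ht)).sub_const a).congr_deriv
        (by simp only [ContinuousLinearMap.coe_fst']; ring))
      (fun t _ h => by linarith [(hball _ h).2]) h0.1.le ht
  have hxr : ∀ t : ℝ, 0 ≤ t → |(γ t).1 - a| < r₀ := fun t ht => by
    have hexp : exp (-(k / 2 / 2) * t) ≤ 1 := exp_le_one_iff.2 (by nlinarith)
    nlinarith [hx t ht]
  have hz : ∀ t : ℝ, 0 ≤ t → |(γ t).2 - 1| ≤ ρ * exp (-(k / 2 / 2) * t) := fun t ht =>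
    abs_le_mul_exp_of_hasDerivAt_neg_mul (y := fun t => (γ t).2 - 1)
      (g := fun t => (3 * (γ t).1 ^ 2 - 2) * ((γ t).2 * ((γ t).2 + 1))) (by positivity) hρ
      (hρr.trans_le (min_le_right _ _))
      (fun t ht => (((hasFDerivAt_snd (𝕜 := ℝ)).comp_hasDerivAt t (hγ t ht)).sub_const 1).congr_deriv
        (by simp only [ContinuousLinearMap.coe_snd']; ring))
      (fun t ht h => by
        have h1 := (hball _ (hxr t ht)).1
        have h2 : 1 / 2 ≤ (γ t).2 * ((γ t).2 + 1) := by nlinarith [(abs_lt.1 h).1]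
        nlinarith) h0.2.le ht
  intro t ht
  rw [Prod.norm_def]
  exact max_le (hx t ht) (hz t ht)
end
end

section
/- Let f : ℝ → ℝ be differentiable and y_c ∈ ℝ. Consider the vector field X on ℝ⁶ in the variables (x₂, x₃, x₄, x, y, s) given by X = ( 2x₂(3x² + x₂ + 2x₃ + 3x₄ − 1), 2x₃(3x² + x₂ + 2x₃ + 3x₄ − 2), 2x₄(3x² + x₂ + 2x₃ + 3x₄ − 3), 3x³ + (x₂ + 2x₃ + 3x₄ − 3)x + √6·s·y², (3x² − √6·s·x + x₂ + 2x₃ + 3x₄)·y, −2√6·x·f(s) ). Then the point P₂₆(y_c) = (0,0,0,0,y_c,0) is an equilibrium of X, the total derivative (Jacobian matrix) of X at this point exists, and its characteristic polynomial equals λ·(λ+2)·(λ+4)·(λ+6)·(λ² + 3λ + 12·f(0)·y_c²); in particular its eigenvalues are 0, −2, −4, −6 and −3/2 ± (1/2)√(9 − 48·f(0)·y_c²). -/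
open Real Polynomial

noncomputable section

/-- The HL vector field beyond detailed balance for an arbitrary potential described by
the `f`-deviser, in the variables `(x₂, x₃, x₄, x, y, s)`. -/
def X17 (f : ℝ → ℝ) (p : Fin 6 → ℝ) : Fin 6 → ℝ :=
  ![2 * p 0 * (3 * p 3 ^ 2 + p 0 + 2 * p 1 + 3 * p 2 - 1),
    2 * p 1 * (3 * p 3 ^ 2 + p 0 + 2 * p 1 + 3 * p 2 - 2),
    2 * p 2 * (3 * p 3 ^ 2 + p 0 + 2 * p 1 + 3 * p 2 - 3),
    3 * p 3 ^ 3 + (p 0 + 2 * p 1 + 3 * p 2 - 3) * p 3 + Real.sqrt 6 * p 5 * p 4 ^ 2,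
    (3 * p 3 ^ 2 - Real.sqrt 6 * p 5 * p 3 + p 0 + 2 * p 1 + 3 * p 2) * p 4,
    -2 * Real.sqrt 6 * p 3 * f (p 5)]

/-- The shape of the Jacobian matrix of `X17 f` at a point of the de Sitter line. -/
def jacobian (a b c : ℝ) : Matrix (Fin 6) (Fin 6) ℝ :=
  !![-2, 0, 0, 0, 0, 0;
     0, -4, 0, 0, 0, 0;
     0, 0, -6, 0, 0, 0;
     0, 0, 0, -3, 0, a;
     c, 2 * c, 3 * c, 0, 0, 0;
     0, 0, 0, b, 0, 0]

theorem charpoly_jacobian (a b c : ℝ) :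
    (jacobian a b c).charpoly =
      Polynomial.X * (Polynomial.X + 2) * (Polynomial.X + 4) * (Polynomial.X + 6) *
        (Polynomial.X ^ 2 + 3 * Polynomial.X - Polynomial.C (a * b)) := by
  have h : (jacobian a b c).charmatrix =
      !![X + 2, 0, 0, 0, 0, 0;
         0, X + 4, 0, 0, 0, 0;
         0, 0, X + 6, 0, 0, 0;
         0, 0, 0, X + 3, 0, -C a;
         -C c, -(2 * C c), -(3 * C c), 0, X, 0;
         0, 0, 0, -C b, 0, X] := by
    ext1 i j
    fin_cases i <;> fin_cases j <;>
      simp [jacobian, C_ofNat]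
  rw [Matrix.charpoly, h]
  simp [Matrix.det_succ_row_zero, Fin.sum_univ_succ, Fin.succAbove, Matrix.submatrix]
  ring

theorem hasFDerivAt_X17 {f : ℝ → ℝ} (hf : DifferentiableAt ℝ f 0) (yc : ℝ) :
    HasFDerivAt (X17 f)
      (LinearMap.toContinuousLinearMap
        (jacobian (Real.sqrt 6 * yc ^ 2) (-2 * Real.sqrt 6 * f 0) yc).mulVecLin)
      ![0, 0, 0, 0, yc, 0] := by
  set p₀ : Fin 6 → ℝ := ![0, 0, 0, 0, yc, 0] with hp₀
  have hp (i : Fin 6) : HasFDerivAt (fun p : Fin 6 → ℝ => p i)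
      (ContinuousLinearMap.proj (R := ℝ) (φ := fun _ : Fin 6 => ℝ) i) p₀ := hasFDerivAt_apply i p₀
  have hf5 : HasFDerivAt (fun p : Fin 6 → ℝ => f (p 5)) _ p₀ :=
    HasDerivAt.comp_hasFDerivAt (h₂ := f) p₀ (h₂' := deriv f 0) hf.hasDerivAt (hp 5)
  have hsum := (((hp 3).pow 2).const_mul 3).add (hp 0) |>.add ((hp 1).const_mul 2)
    |>.add ((hp 2).const_mul 3)
  rw [hasFDerivAt_pi']
  intro i
  fin_cases i
  · refine (((hp 0).const_mul 2).mul (hsum.sub_const 1)).congr_fderiv ?_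
    ext v
    simp [hp₀, jacobian, dotProduct, Fin.sum_univ_succ]
  · refine (((hp 1).const_mul 2).mul (hsum.sub_const 2)).congr_fderiv ?_
    ext v
    simp [hp₀, jacobian, dotProduct, Fin.sum_univ_succ]
    ring
  · refine (((hp 2).const_mul 2).mul (hsum.sub_const 3)).congr_fderiv ?_
    ext v
    simp [hp₀, jacobian, dotProduct, Fin.sum_univ_succ]
    ring
  · refine (((((hp 3).pow 3).const_mul 3).add
      ((((hp 0).add ((hp 1).const_mul 2)).add ((hp 2).const_mul 3)).sub_const 3 |>.mul (hp 3))).add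
      (((hp 5).const_mul (Real.sqrt 6)).mul ((hp 4).pow 2))).congr_fderiv ?_
    ext v
    simp [hp₀, jacobian, dotProduct, Fin.sum_univ_succ]
    ring
  · refine ((((((hp 3).pow 2).const_mul 3).sub (((hp 5).const_mul (Real.sqrt 6)).mul (hp 3))).add
      (hp 0) |>.add ((hp 1).const_mul 2) |>.add ((hp 2).const_mul 3)).mul (hp 4)).congr_fderiv ?_
    ext v
    simp [hp₀, jacobian, dotProduct, Fin.sum_univ_succ]
    ring
  · refine (((hp 3).const_mul (-2 * Real.sqrt 6)).mul hf5).congr_fderiv ?_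
    ext v
    simp [hp₀, jacobian, dotProduct, Fin.sum_univ_succ]
    ring

theorem stmt_17 (f : ℝ → ℝ) (hf : Differentiable ℝ f) (yc : ℝ) :
    X17 f ![0, 0, 0, 0, yc, 0] = 0 ∧
      ∃ A : Matrix (Fin 6) (Fin 6) ℝ,
        HasFDerivAt (X17 f) (LinearMap.toContinuousLinearMap A.mulVecLin)
          ![0, 0, 0, 0, yc, 0] ∧
        A.charpoly =
          Polynomial.X * (Polynomial.X + 2) * (Polynomial.X + 4) * (Polynomial.X + 6) *
            (Polynomial.X ^ 2 + 3 * Polynomial.X + Polynomial.C (12 * f 0 * yc ^ 2)) := by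
  refine ⟨?_, _, hasFDerivAt_X17 (hf 0) yc, ?_⟩
  · ext i
    fin_cases i <;> simp [X17]
  · have hC : Real.sqrt 6 * yc ^ 2 * (-2 * Real.sqrt 6 * f 0) = -(12 * f 0 * yc ^ 2) := by
      linear_combination (-2 * f 0 * yc ^ 2) * Real.mul_self_sqrt (show (0 : ℝ) ≤ 6 by norm_num)
    rw [charpoly_jacobian, hC, C_neg, sub_neg_eq_add]
end
end
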